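/- arXiv:2102.11689 — 2 statements merged into one kernel-verified Lean document; each statement's English description precedes it below -/
import Mathlib

section
/- There exists an absolute constant C > 0 such that for every real-valued random variable X with characteristic function ψ(t) = E[exp(i t X)], one has P(|X| ≤ 1) ≤ C · ∫_{-1}^{1} |ψ(t)| dt. -/
open MeasureTheory ProbabilityTheory

/-- The Fourier transform of the triangle function, in terms of a half-interval. -/
lemma integral_triangle_mul_cos (x : ℝ) :
    ∫ t in Set.Icc (-1 : ℝ) 1, (1 - |t|) * Real.cos (t * x) =
      2 * ∫ t in (0 : ℝ)..1, (1 - t) * Real.cos (t * x) := by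
  have hc : Continuous fun t : ℝ => (1 - |t|) * Real.cos (t * x) := by fun_prop
  rw [integral_Icc_eq_integral_Ioc, ← intervalIntegral.integral_of_le (by norm_num),
    ← intervalIntegral.integral_add_adjacent_intervals (b := 0)
      (hc.intervalIntegrable _ _) (hc.intervalIntegrable _ _)]
  have hneg : ∫ t in (-1 : ℝ)..0, (1 - |t|) * Real.cos (t * x) =
      ∫ t in (0 : ℝ)..1, (1 - |t|) * Real.cos (t * x) := by
    have h := intervalIntegral.integral_comp_neg (a := 0) (b := 1)
      (fun t : ℝ => (1 - |t|) * Real.cos (t * x))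
    simpa using h.symm
  have habs : ∫ t in (0 : ℝ)..1, (1 - |t|) * Real.cos (t * x) =
      ∫ t in (0 : ℝ)..1, (1 - t) * Real.cos (t * x) := by
    refine intervalIntegral.integral_congr fun t ht => ?_
    rw [Set.uIcc_of_le zero_le_one] at ht
    simp only [abs_of_nonneg ht.1]
  rw [hneg, habs, two_mul]

lemma integral_one_sub_mul_cos {x : ℝ} (hx : x ≠ 0) :
    ∫ t in (0 : ℝ)..1, (1 - t) * Real.cos (t * x) = (1 - Real.cos x) / x ^ 2 := by
  have hc : Continuous fun t : ℝ => (1 - t) * Real.cos (t * x) := by fun_prop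
  rw [intervalIntegral.integral_eq_sub_of_hasDerivAt
    (f := fun t => (1 - t) * Real.sin (t * x) / x - Real.cos (t * x) / x ^ 2) _
    (hc.intervalIntegrable _ _)]
  · simp
    ring
  · intro t _
    have hm : HasDerivAt (fun t : ℝ => t * x) x t := by
      simpa using (hasDerivAt_id t).mul_const x
    have h := ((((hasDerivAt_id t).const_sub 1).mul hm.sin).div_const x).sub
      (hm.cos.div_const (x ^ 2))
    refine h.congr_deriv ?_
    simp only [id]
    field_simp
    ring

lemma integral_one_sub : ∫ t in (0 : ℝ)..1, (1 - t) = 1 / 2 := by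
  rw [intervalIntegral.integral_sub (by simp) (by simp)]
  norm_num

lemma integral_triangle_mul_cos_nonneg (x : ℝ) :
    0 ≤ ∫ t in Set.Icc (-1 : ℝ) 1, (1 - |t|) * Real.cos (t * x) := by
  rw [integral_triangle_mul_cos]
  rcases eq_or_ne x 0 with rfl | hx
  · norm_num [integral_one_sub]
  · rw [integral_one_sub_mul_cos hx]
    have := Real.cos_le_one x
    have : 0 ≤ 1 - Real.cos x := by linarith
    positivity

lemma half_le_integral_triangle_mul_cos {x : ℝ} (h : |x| ≤ 1) :
    1 / 2 ≤ ∫ t in Set.Icc (-1 : ℝ) 1, (1 - |t|) * Real.cos (t * x) := by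
  rw [integral_triangle_mul_cos]
  rcases eq_or_ne x 0 with rfl | hx
  · norm_num [integral_one_sub]
  · rw [integral_one_sub_mul_cos hx]
    have hb := (abs_le.1 (Real.cos_bound h)).2
    have hx2 : 0 < x ^ 2 := by positivity
    have h1 : x ^ 2 ≤ 1 := (sq_le_one_iff_abs_le_one x).2 h
    have h4 : |x| ^ 4 = x ^ 2 * x ^ 2 := by
      rw [← sq_abs x]
      ring
    rw [h4] at hb
    have : 1 / 4 ≤ (1 - Real.cos x) / x ^ 2 := by
      rw [le_div_iff₀ hx2]
      nlinarith
    linarith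

/-- Halász' inequality: there is an absolute constant `C > 0` such that for every
real-valued random variable `X` with characteristic function `ψ(t) = E[exp(i t X)]`,
one has `P(|X| ≤ 1) ≤ C · ∫_{-1}^{1} |ψ(t)| dt`. -/
theorem halasz_inequality :
    ∃ C : ℝ, 0 < C ∧
      ∀ (Ω : Type) (_ : MeasureSpace Ω) (_ : IsProbabilityMeasure (ℙ : Measure Ω))
        (X : Ω → ℝ), Measurable X →
        (ℙ {ω | |X ω| ≤ 1}).toReal ≤
          C * ∫ t in Set.Icc (-1 : ℝ) 1,
            ‖∫ ω, Complex.exp (t * X ω * Complex.I) ∂ℙ‖ := by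
  refine ⟨2, two_pos, fun Ω _ _ X hX => ?_⟩
  set g : ℝ → ℝ := fun x => ∫ t in Set.Icc (-1 : ℝ) 1, (1 - |t|) * Real.cos (t * x)
  set ν : Measure ℝ := volume.restrict (Set.Icc (-1 : ℝ) 1)
  have hmem : ∀ᵐ t ∂ν, t ∈ Set.Icc (-1 : ℝ) 1 := ae_restrict_mem measurableSet_Icc
  have hprod : Integrable (fun p : Ω × ℝ => (1 - |p.2|) * Real.cos (p.2 * X p.1))
      ((ℙ : Measure Ω).prod ν) := by
    refine Integrable.of_bound (C := 1) (by fun_prop) ?_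
    filter_upwards [Measure.quasiMeasurePreserving_snd.ae hmem] with p hp
    have hp' : |p.2| ≤ 1 := abs_le.2 hp
    rw [norm_mul, Real.norm_eq_abs, Real.norm_eq_abs, abs_of_nonneg (by linarith)]
    exact mul_le_one₀ (by linarith [abs_nonneg p.2]) (abs_nonneg _) (Real.abs_cos_le_one _)
  have hset : MeasurableSet {ω | |X ω| ≤ 1} := measurableSet_le (by fun_prop) measurable_const
  have hlower : (ℙ {ω | |X ω| ≤ 1}).toReal * (1 / 2) ≤ ∫ ω, g (X ω) := by
    have hind : ∫ ω, Set.indicator {ω | |X ω| ≤ 1} (fun _ => (1 / 2 : ℝ)) ω =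
        (ℙ {ω | |X ω| ≤ 1}).toReal * (1 / 2) := by
      rw [integral_indicator_const _ hset, smul_eq_mul, measureReal_def]
    rw [← hind]
    refine integral_mono ((integrable_const _).indicator hset) hprod.integral_prod_left ?_
    refine Set.indicator_le' (fun ω hω => half_le_integral_triangle_mul_cos hω)
      fun ω _ => integral_triangle_mul_cos_nonneg (X ω)
  have hswap : ∫ ω, g (X ω) = ∫ t, (∫ ω, (1 - |t|) * Real.cos (t * X ω)) ∂ν :=
    integral_integral_swap hprod
  have hexp_norm (t : ℝ) (ω : Ω) : ‖Complex.exp (t * X ω * Complex.I)‖ = 1 := by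
    rw [← Complex.ofReal_mul, Complex.norm_exp_ofReal_mul_I]
  have hexp_int (t : ℝ) : Integrable fun ω => Complex.exp (t * X ω * Complex.I) :=
    Integrable.of_bound (C := 1) (by fun_prop) (ae_of_all _ fun ω => (hexp_norm t ω).le)
  have hψ_int : Integrable (fun t : ℝ => ‖∫ ω, Complex.exp (t * X ω * Complex.I)‖) ν := by
    have hmeas : StronglyMeasurable
        fun p : ℝ × Ω => Complex.exp (p.1 * X p.2 * Complex.I) :=
      Measurable.stronglyMeasurable (by fun_prop)
    refine Integrable.norm (Integrable.of_bound (C := 1)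
      (hmeas.integral_prod_right (ν := ℙ)).aestronglyMeasurable (ae_of_all _ fun t => ?_))
    refine (norm_integral_le_of_norm_le_const (C := 1)
      (ae_of_all _ fun ω => (hexp_norm t ω).le)).trans ?_
    simp
  have hupper : ∫ t, (∫ ω, (1 - |t|) * Real.cos (t * X ω)) ∂ν ≤
      ∫ t, ‖∫ ω, Complex.exp (t * X ω * Complex.I)‖ ∂ν := by
    refine integral_mono_ae hprod.integral_prod_right hψ_int ?_
    filter_upwards [hmem] with t ht
    have ht' : |t| ≤ 1 := abs_le.2 ht
    have hre : ∫ ω, Real.cos (t * X ω) = (∫ ω, Complex.exp (t * X ω * Complex.I)).re := by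
      refine Eq.trans ?_ (integral_re (hexp_int t))
      refine integral_congr_ae (ae_of_all _ fun ω => ?_)
      simp [← Complex.ofReal_mul, Complex.exp_ofReal_mul_I_re]
    rw [integral_const_mul, hre]
    calc _ ≤ (1 - |t|) * ‖∫ ω, Complex.exp (t * X ω * Complex.I)‖ :=
          mul_le_mul_of_nonneg_left (Complex.re_le_norm _) (by linarith)
      _ ≤ _ := mul_le_of_le_one_left (norm_nonneg _) (by linarith [abs_nonneg t])
  linarith
end

section
/- Let n ≥ 1 and write points of ℝⁿ⁺¹ = ℝⁿ × ℝ as (x, t) with x ∈ ℝⁿ, t ∈ ℝ. For a ball B ⊂ ℝⁿ⁺¹ let B⁺ = B ∩ { (x,t) : t ≥ 0 }. There exist constants β ∈ (0,1) and C > 0, depending only on n, such that the following holds: if u is twice continuously differentiable and harmonic on the ball B(0,2) ⊂ ℝⁿ⁺¹ (i.e. ∂t²u + ∑_{i=1}^{n} ∂²u/∂x_i² = 0 there) and u(x, 0) = 0 for all (x,0) ∈ B(0,2), then sup_{B(0,1)⁺} |u| ≤ C · ( sup_{(x,0) ∈ B(0,1)} |∂_t u(x,0)| )^{β} · ( sup_{B(0,2)⁺}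 |u| )^{1-β}. -/
open MeasureTheory Metric

/-- The profile `(1 - ‖y‖²)₊` of the averaging kernel. -/
noncomputable def avgKernel {E : Type*} [NormedAddCommGroup E] (y : E) : ℝ :=
  max 0 (1 - ‖y‖ ^ 2)

/-- A potential of the averaging kernel: its gradient at `y` is `-avgKernel y • y`. -/
noncomputable def avgPotential {E : Type*} [NormedAddCommGroup E] (y : E) : ℝ :=
  max 0 (1 - ‖y‖ ^ 2) ^ 2 / 4

section Kernel

variable {E : Type*} [NormedAddCommGroup E]

theorem avgKernel_nonneg (y : E) : 0 ≤ avgKernel y := le_max_left _ _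

theorem avgKernel_eq_zero {y : E} (hy : 1 ≤ ‖y‖) : avgKernel y = 0 := by
  apply max_eq_left
  nlinarith

theorem avgPotential_nonneg (y : E) : 0 ≤ avgPotential y := by
  unfold avgPotential; positivity

theorem avgPotential_le_one (y : E) : avgPotential y ≤ 1 := by
  unfold avgPotential
  have h0 : 0 ≤ max 0 (1 - ‖y‖ ^ 2) := le_max_left _ _
  have h1 : max 0 (1 - ‖y‖ ^ 2) ≤ 1 := max_le zero_le_one (by nlinarith [norm_nonneg y])
  nlinarith

theorem avgPotential_eq_zero {y : E} (hy : 1 ≤ ‖y‖) : avgPotential y = 0 := by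
  have : max 0 (1 - ‖y‖ ^ 2) = 0 := avgKernel_eq_zero hy
  simp [avgPotential, this]

@[fun_prop]
theorem continuous_avgKernel : Continuous (avgKernel : E → ℝ) := by
  unfold avgKernel; fun_prop

@[fun_prop]
theorem continuous_avgPotential : Continuous (avgPotential : E → ℝ) := by
  unfold avgPotential; fun_prop

theorem abs_avgKernel_sub_le (y z : E) : |avgKernel y - avgKernel z| ≤ 2 * ‖y - z‖ := by
  have key : ∀ w : E, avgKernel w = 1 - min 1 ‖w‖ ^ 2 := by
    intro w
    rcases le_total 1 ‖w‖ with h | h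
    · rw [avgKernel_eq_zero h, min_eq_left h]; norm_num
    · rw [min_eq_right h]; exact max_eq_right (by nlinarith [norm_nonneg w])
  rw [key, key]
  have h1 : |min 1 ‖y‖ - min 1 ‖z‖| ≤ ‖y - z‖ := by
    refine (abs_min_sub_min_le_max 1 ‖y‖ 1 ‖z‖).trans ?_
    simpa using abs_norm_sub_norm_le y z
  have h2 : 1 - min 1 ‖y‖ ^ 2 - (1 - min 1 ‖z‖ ^ 2)
      = -((min 1 ‖y‖ - min 1 ‖z‖) * (min 1 ‖y‖ + min 1 ‖z‖)) := by ring
  have h3 : |min 1 ‖y‖ + min 1 ‖z‖| ≤ 2 := by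
    rw [abs_of_nonneg (by positivity)]
    linarith [min_le_left 1 ‖y‖, min_le_left 1 ‖z‖]
  rw [h2, abs_neg, abs_mul, mul_comm]
  gcongr

end Kernel

theorem hasDerivAt_max_zero_sq (s : ℝ) :
    HasDerivAt (fun s : ℝ => max 0 s ^ 2) (2 * max 0 s) s := by
  rcases lt_trichotomy s 0 with h | rfl | h
  · have : (fun s : ℝ => max 0 s ^ 2) =ᶠ[nhds s] fun _ => 0 := by
      filter_upwards [gt_mem_nhds h] with t ht
      simp [max_eq_left ht.le]
    rw [max_eq_left h.le, mul_zero]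
    exact (hasDerivAt_const s (0 : ℝ)).congr_of_eventuallyEq this
  · rw [hasDerivAt_iff_isLittleO_nhds_zero]
    simp only [zero_add, max_self, mul_zero, smul_zero, sub_zero, ne_eq, OfNat.ofNat_ne_zero,
      not_false_eq_true, zero_pow]
    refine Asymptotics.IsBigO.trans_isLittleO (g := fun t : ℝ => t ^ 2) ?_ ?_
    · refine Asymptotics.IsBigO.of_bound 1 (Filter.Eventually.of_forall fun t => ?_)
      rw [one_mul, norm_pow, norm_pow]
      gcongr
      simp only [Real.norm_eq_abs]
      rw [abs_of_nonneg (le_max_left _ _)]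
      exact max_le (abs_nonneg _) (le_abs_self _)
    · simpa using Asymptotics.isLittleO_pow_id (𝕜 := ℝ) one_lt_two
  · have : (fun s : ℝ => max 0 s ^ 2) =ᶠ[nhds s] fun t => t ^ 2 := by
      filter_upwards [lt_mem_nhds h] with t ht
      simp [max_eq_right ht.le]
    rw [max_eq_right h.le]
    simpa using (hasDerivAt_pow 2 s).congr_of_eventuallyEq this

section InnerProduct

variable {E : Type*} [NormedAddCommGroup E] [InnerProductSpace ℝ E]

theorem hasFDerivAt_avgPotential (y : E) :
    HasFDerivAt avgPotential (-(avgKernel y) • innerSL ℝ y) y := by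
  have h1 : HasFDerivAt (fun y : E => 1 - ‖y‖ ^ 2) (-(2 • innerSL ℝ y)) y :=
    (hasStrictFDerivAt_norm_sq y).hasFDerivAt.const_sub 1
  have h2 := ((hasDerivAt_max_zero_sq (1 - ‖y‖ ^ 2)).comp_hasFDerivAt y h1).mul_const (1 / 4 : ℝ)
  have h3 : (avgPotential : E → ℝ)
      = fun y => ((fun s : ℝ => max 0 s ^ 2) ∘ fun y : E => 1 - ‖y‖ ^ 2) y * (1 / 4) := by
    ext y; simp [avgPotential]; ring
  rw [h3]
  refine h2.congr_fderiv ?_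
  ext w
  simp [avgKernel]
  ring

theorem fderiv_avgPotential (y w : E) :
    fderiv ℝ avgPotential y w = -(avgKernel y * inner ℝ y w) := by
  rw [(hasFDerivAt_avgPotential y).fderiv]; simp

theorem hasCompactSupport_avgKernel [FiniteDimensional ℝ E] :
    HasCompactSupport (avgKernel : E → ℝ) :=
  HasCompactSupport.intro (isCompact_closedBall (0 : E) 1) fun y hy =>
    avgKernel_eq_zero (by simpa using (not_le.1 (by simpa using hy)).le)

theorem hasCompactSupport_avgPotential [FiniteDimensional ℝ E] :
    HasCompactSupport (avgPotential : E → ℝ) :=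
  HasCompactSupport.intro (isCompact_closedBall (0 : E) 1) fun y hy =>
    avgPotential_eq_zero (by simpa using (not_le.1 (by simpa using hy)).le)

variable [FiniteDimensional ℝ E] [MeasurableSpace E] [BorelSpace E]

theorem integral_avgKernel_pos : 0 < ∫ y : E, avgKernel y :=
  (continuous_avgKernel).integral_pos_of_hasCompactSupport_nonneg_nonzero
    hasCompactSupport_avgKernel avgKernel_nonneg (x := 0) (by simp [avgKernel])

theorem integrable_avgKernel_mul {f : E → ℝ} (hf : Continuous f) :
    Integrable (fun y => avgKernel y * f y) :=
  (continuous_avgKernel.mul hf).integrable_of_hasCompactSupport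
    hasCompactSupport_avgKernel.mul_right

theorem integrable_avgPotential_mul {f : E → ℝ} (hf : Continuous f) :
    Integrable (fun y => avgPotential y * f y) :=
  (continuous_avgPotential.mul hf).integrable_of_hasCompactSupport
    hasCompactSupport_avgPotential.mul_right

/-- The unnormalised average of `v` over the ball of radius `ρ` about `x`, weighted by
`avgKernel`. -/
noncomputable def ballAvg (ρ : ℝ) (v : E → ℝ) (x : E) : ℝ :=
  ∫ y, avgKernel y * v (x + ρ • y)

end InnerProduct

theorem ContDiff.fderiv_two_apply_const {E : Type*} [NormedAddCommGroup E] [NormedSpace ℝ E]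
    {v : E → ℝ} (hv : ContDiff ℝ 2 v) (w : E) : ContDiff ℝ 1 fun y => fderiv ℝ v y w :=
  (hv.fderiv_right (m := 1) (by norm_num)).clm_apply contDiff_const

section Laplacian

variable {ι : Type*} [Fintype ι] [DecidableEq ι]

/-- The Laplacian in Euclidean coordinates. -/
noncomputable def coordLaplacian (v : EuclideanSpace ℝ ι → ℝ) (z : EuclideanSpace ℝ ι) : ℝ :=
  ∑ i, fderiv ℝ (fun y => fderiv ℝ v y (EuclideanSpace.single i (1 : ℝ))) z
    (EuclideanSpace.single i (1 : ℝ))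

theorem integral_avgKernel_mul_fderiv {v : EuclideanSpace ℝ ι → ℝ} (hv : ContDiff ℝ 2 v)
    (x : EuclideanSpace ℝ ι) (σ : ℝ) :
    ∫ y, avgKernel y * fderiv ℝ v (x + σ • y) y
      = σ * ∫ y, avgPotential y * coordLaplacian v (x + σ • y) := by
  set e : ι → EuclideanSpace ℝ ι := fun i => EuclideanSpace.single i (1 : ℝ) with he
  have hc : ∀ i, ContDiff ℝ 1 fun y => fderiv ℝ v y (e i) := fun i => hv.fderiv_two_apply_const _
  have hg : ∀ i, ContDiff ℝ 1 fun y => fderiv ℝ v (x + σ • y) (e i) := fun i =>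
    (hc i).comp (by fun_prop)
  have hcc : ∀ i, Continuous fun y => fderiv ℝ (fun y => fderiv ℝ v y (e i)) (x + σ • y) (e i) :=
    fun i => (((hc i).continuous_fderiv one_ne_zero).clm_apply continuous_const).comp (by fun_prop)
  have hd : ∀ i y, fderiv ℝ (fun y => fderiv ℝ v (x + σ • y) (e i)) y (e i)
      = σ * fderiv ℝ (fun y => fderiv ℝ v y (e i)) (x + σ • y) (e i) := by
    intro i y
    have h1 : HasFDerivAt (fun y : EuclideanSpace ℝ ι => x + σ • y)
        (σ • ContinuousLinearMap.id ℝ _) y := ((hasFDerivAt_id y).const_smul σ).const_add x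
    have h2 := ((hc i).differentiable one_ne_zero (x + σ • y)).hasFDerivAt.comp y h1
    have h3 : fderiv ℝ (fun y => fderiv ℝ v (x + σ • y) (e i)) y = _ := h2.fderiv
    rw [h3]; simp
  have hi : ∀ i, ∫ y, avgKernel y * (y i * fderiv ℝ v (x + σ • y) (e i))
      = σ * ∫ y, avgPotential y *
        fderiv ℝ (fun y => fderiv ℝ v y (e i)) (x + σ • y) (e i) := by
    intro i
    have hfd : ∀ y, fderiv ℝ avgPotential y (e i) = -(avgKernel y * y i) := by
      intro y
      rw [fderiv_avgPotential]; simp [he, EuclideanSpace.inner_single_right]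
    have := integral_mul_fderiv_eq_neg_fderiv_mul_of_integrable (μ := volume)
      (f := avgPotential) (g := fun y => fderiv ℝ v (x + σ • y) (e i)) (v := e i) ?_ ?_ ?_
      (fun y _ => (hasFDerivAt_avgPotential y).differentiableAt)
      (fun y _ => (hg i).differentiable one_ne_zero y)
    · simp only [hfd, hd, neg_mul, integral_neg, neg_neg] at this
      rw [← integral_const_mul]
      simp only [mul_assoc] at this
      rw [← this]
      congr 1; ext y; ring
    · simp only [hfd, neg_mul, mul_assoc]
      refine (integrable_avgKernel_mul ?_).neg
      exact (by fun_prop : Continuous fun y : EuclideanSpace ℝ ι => y i).mul (hg i).continuous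
    · exact integrable_avgPotential_mul
        (((hg i).continuous_fderiv one_ne_zero).clm_apply continuous_const)
    · exact integrable_avgPotential_mul (hg i).continuous
  have hsum : ∀ y : EuclideanSpace ℝ ι, fderiv ℝ v (x + σ • y) y
      = ∑ i, y i * fderiv ℝ v (x + σ • y) (e i) := by
    intro y
    have h1 : y = ∑ i, y i • e i := by
      have := (EuclideanSpace.basisFun ι ℝ).sum_repr y
      simpa [he] using this.symm
    conv_lhs => rw [h1, ← h1]
    nth_rewrite 2 [h1]
    rw [map_sum]
    simp
  simp only [hsum, Finset.mul_sum, coordLaplacian]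
  rw [integral_finsetSum, integral_finsetSum, Finset.mul_sum]
  · exact Finset.sum_congr rfl fun i _ => hi i
  · exact fun i _ => integrable_avgPotential_mul (hcc i)
  · exact fun i _ => integrable_avgKernel_mul
      ((by fun_prop : Continuous fun y : EuclideanSpace ℝ ι => y i).mul (hg i).continuous)

theorem hasDerivAt_ballAvg {v : EuclideanSpace ℝ ι → ℝ} (hv : ContDiff ℝ 2 v)
    (x : EuclideanSpace ℝ ι) (σ : ℝ) :
    HasDerivAt (fun σ => ballAvg σ v x)
      (σ * ∫ y, avgPotential y * coordLaplacian v (x + σ • y)) σ := by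
  rw [← integral_avgKernel_mul_fderiv hv]
  have hfd : Continuous (fderiv ℝ v) := hv.continuous_fderiv two_ne_zero
  have hcont : ∀ τ : ℝ, Continuous fun y : EuclideanSpace ℝ ι => fderiv ℝ v (x + τ • y) y :=
    fun τ => (hfd.comp (by fun_prop)).clm_apply continuous_id
  obtain ⟨K, hK⟩ := (isCompact_closedBall x (|σ| + 1)).exists_bound_of_continuousOn
    hfd.continuousOn
  refine (hasDerivAt_integral_of_dominated_loc_of_deriv_le
    (F := fun τ y => avgKernel y * v (x + τ • y))
    (F' := fun τ y => avgKernel y * fderiv ℝ v (x + τ • y) y)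
    (bound := fun y => avgKernel y * K) (s := ball σ 1) (ball_mem_nhds σ one_pos)
    ?_ ?_ ?_ ?_ ?_ ?_).2
  · exact Filter.Eventually.of_forall fun τ =>
      (integrable_avgKernel_mul (hv.continuous.comp (by fun_prop))).aestronglyMeasurable
  · exact integrable_avgKernel_mul (hv.continuous.comp (by fun_prop))
  · exact (integrable_avgKernel_mul (hcont σ)).aestronglyMeasurable
  · refine Filter.Eventually.of_forall fun y τ hτ => ?_
    rcases le_total 1 ‖y‖ with hy | hy
    · simp [avgKernel_eq_zero hy]
    · rw [norm_mul, Real.norm_of_nonneg (avgKernel_nonneg y)]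
      refine mul_le_mul_of_nonneg_left ?_ (avgKernel_nonneg y)
      have hτ' : |τ| ≤ |σ| + 1 := by
        have h1 : |τ - σ| < 1 := by simpa [Real.dist_eq] using hτ
        have h2 := abs_sub_abs_le_abs_sub τ σ
        linarith
      have hmem : x + τ • y ∈ closedBall x (|σ| + 1) := by
        simp only [mem_closedBall, dist_self_add_left, norm_smul, Real.norm_eq_abs]
        nlinarith [norm_nonneg y, abs_nonneg τ]
      calc ‖fderiv ℝ v (x + τ • y) y‖ ≤ ‖fderiv ℝ v (x + τ • y)‖ * ‖y‖ :=
            ContinuousLinearMap.le_opNorm _ _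
        _ ≤ K * 1 := mul_le_mul (hK _ hmem) hy (norm_nonneg _)
            ((norm_nonneg _).trans (hK _ hmem))
        _ = K := mul_one K
  · exact integrable_avgKernel_mul continuous_const
  · refine Filter.Eventually.of_forall fun y τ _ => ?_
    have h1 : HasDerivAt (fun τ : ℝ => x + τ • y) y τ := by
      simpa using ((hasDerivAt_id τ).smul_const y).const_add x
    exact (((hv.differentiable two_ne_zero (x + τ • y)).hasFDerivAt.comp_hasDerivAt τ h1)).const_mul
      (avgKernel y)

end Laplacian

section BallAvg

variable {E : Type*} [NormedAddCommGroup E] [InnerProductSpace ℝ E] [FiniteDimensional ℝ E]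
  [MeasurableSpace E] [BorelSpace E]

theorem add_smul_mem_closedBall {E : Type*} [NormedAddCommGroup E] [NormedSpace ℝ E] {ρ : ℝ}
    (hρ : 0 ≤ ρ) (x : E) {y : E} (hy : ‖y‖ ≤ 1) : x + ρ • y ∈ closedBall x ρ := by
  rw [mem_closedBall, dist_self_add_left, norm_smul, Real.norm_of_nonneg hρ]
  exact mul_le_of_le_one_right hρ hy

theorem abs_ballAvg_sub_le {v w : E → ℝ} (hv : Continuous v) (hw : Continuous w) {ρ D : ℝ}
    (hρ : 0 ≤ ρ) {x : E} (h : ∀ z ∈ closedBall x ρ, |v z - w z| ≤ D) :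
    |ballAvg ρ v x - ballAvg ρ w x| ≤ (∫ y : E, avgKernel y) * D := by
  have hvi : Integrable fun y => avgKernel y * v (x + ρ • y) :=
    integrable_avgKernel_mul (hv.comp (by fun_prop))
  have hwi : Integrable fun y => avgKernel y * w (x + ρ • y) :=
    integrable_avgKernel_mul (hw.comp (by fun_prop))
  unfold ballAvg
  rw [← integral_sub hvi hwi, ← integral_mul_const, ← Real.norm_eq_abs]
  refine norm_integral_le_of_norm_le (integrable_avgKernel_mul continuous_const)
    (Filter.Eventually.of_forall fun y => ?_)
  rcases le_total 1 ‖y‖ with hy | hy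
  · simp [avgKernel_eq_zero hy]
  · rw [← mul_sub, norm_mul, Real.norm_of_nonneg (avgKernel_nonneg y)]
    exact mul_le_mul_of_nonneg_left (h _ (add_smul_mem_closedBall hρ x hy)) (avgKernel_nonneg y)

end BallAvg

section Slab

variable {ι : Type*} [Fintype ι] [DecidableEq ι]

theorem volume_closedBall_inter_slab_le (j : ι) (a : ℝ) {w : ℝ} (hw : 0 ≤ w) :
    volume (closedBall (0 : EuclideanSpace ℝ ι) 1 ∩ {y | y j ∈ Set.Icc a (a + w)})
      ≤ ENNReal.ofReal (2 ^ Fintype.card ι * w) := by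
  set s : ι → Set ℝ := fun i => if i = j then Set.Icc a (a + w) else Set.Icc (-1) 1 with hs
  have hsub : closedBall (0 : EuclideanSpace ℝ ι) 1 ∩ {y | y j ∈ Set.Icc a (a + w)}
      ⊆ (MeasurableEquiv.toLp 2 (ι → ℝ)).symm ⁻¹' (Set.univ.pi s) := by
    rintro y ⟨hy, hyj⟩ i -
    by_cases hij : i = j
    · subst hij; simpa [hs] using hyj
    · have h1 : ‖y i‖ ≤ 1 := (PiLp.norm_apply_le y i).trans (by simpa using hy)
      simpa [hs, hij] using abs_le.1 h1
  refine (measure_mono hsub).trans ?_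
  rw [(EuclideanSpace.volume_preserving_symm_measurableEquiv_toLp ι).measure_preimage_equiv,
    volume_pi_pi, ← Finset.mul_prod_erase _ _ (Finset.mem_univ j)]
  have h2 : ∀ i ∈ Finset.univ.erase j, volume (s i) = ENNReal.ofReal 2 := by
    intro i hi
    simp only [hs, if_neg (Finset.ne_of_mem_erase hi), Real.volume_Icc]
    norm_num
  rw [Finset.prod_congr rfl h2, Finset.prod_const, ← ENNReal.ofReal_pow zero_le_two]
  simp only [hs, if_true, Real.volume_Icc, add_sub_cancel_left]
  rw [← ENNReal.ofReal_mul hw, mul_comm]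
  refine ENNReal.ofReal_le_ofReal (mul_le_mul_of_nonneg_right ?_ hw)
  exact pow_le_pow_right₀ one_le_two (by simp [Finset.card_erase_of_mem])

theorem abs_ballAvg_sub_le_of_laplacian_slab {v : EuclideanSpace ℝ ι → ℝ} (hv : ContDiff ℝ 2 v)
    (j : ι) {x : EuclideanSpace ℝ ι} {ρ η B : ℝ} (hρ : 0 ≤ ρ) (hη : 0 ≤ η) (hB : 0 ≤ B)
    (hin : ∀ z ∈ closedBall x ρ, z j ∈ Set.Icc 0 η → |coordLaplacian v z| ≤ B)
    (hout : ∀ z ∈ closedBall x ρ, z j ∉ Set.Icc 0 η → coordLaplacian v z = 0) :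
    |ballAvg ρ v x - (∫ y : EuclideanSpace ℝ ι, avgKernel y) * v x|
      ≤ 2 ^ Fintype.card ι * η * B * ρ := by
  have h0 : ballAvg 0 v x = (∫ y : EuclideanSpace ℝ ι, avgKernel y) * v x := by
    simp [ballAvg, integral_mul_const]
  have key := norm_image_sub_le_of_norm_deriv_le_segment' (f := fun σ => ballAvg σ v x)
    (a := 0) (b := ρ) (C := 2 ^ Fintype.card ι * η * B)
    (fun σ _ => (hasDerivAt_ballAvg hv x σ).hasDerivWithinAt) ?_ ρ ⟨hρ, le_rfl⟩
  · rw [← h0]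
    simpa using key
  · rintro σ ⟨hσ0, hσρ⟩
    rcases hσ0.eq_or_lt with rfl | hσ
    · simp; positivity
    set S : Set (EuclideanSpace ℝ ι) :=
      closedBall 0 1 ∩ {y | y j ∈ Set.Icc (-(x j) / σ) (-(x j) / σ + η / σ)} with hS
    have hSm : MeasurableSet S :=
      isClosed_closedBall.measurableSet.inter
        ((isClosed_Icc.preimage (by fun_prop : Continuous fun y : EuclideanSpace ℝ ι => y j))
          |>.measurableSet)
    have hvol := volume_closedBall_inter_slab_le j (-(x j) / σ) (div_nonneg hη hσ0)
    have hfin : volume S ≠ ⊤ := (hvol.trans_lt ENNReal.ofReal_lt_top).ne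
    have hreal : volume.real S ≤ 2 ^ Fintype.card ι * (η / σ) :=
      ENNReal.toReal_le_of_le_ofReal (by positivity) hvol
    have hint : ‖∫ y, avgPotential y * coordLaplacian v (x + σ • y)‖
        ≤ ∫ y, S.indicator (fun _ => B) y := by
      refine norm_integral_le_of_norm_le ((integrable_indicator_iff hSm).2
        (integrableOn_const hfin)) (Filter.Eventually.of_forall fun y => ?_)
      rcases le_or_gt ‖y‖ 1 with hy | hy
      · have hmem : x + σ • y ∈ closedBall x ρ :=
          closedBall_subset_closedBall hσρ.le (add_smul_mem_closedBall hσ0 x hy)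
        have hiff : y ∈ S ↔ (x + σ • y) j ∈ Set.Icc 0 η := by
          simp only [hS, Set.mem_inter_iff, mem_closedBall_zero_iff, hy, true_and,
            Set.mem_ofPred_eq, Set.mem_Icc, ← add_div, div_le_iff₀ hσ, le_div_iff₀ hσ,
            PiLp.add_apply, PiLp.smul_apply, smul_eq_mul]
          constructor <;> rintro ⟨h1, h2⟩ <;> constructor <;> linarith
        by_cases hyS : y ∈ S
        · rw [Set.indicator_of_mem hyS, norm_mul, Real.norm_of_nonneg (avgPotential_nonneg y)]
          exact (mul_le_of_le_one_left (norm_nonneg _) (avgPotential_le_one y)).trans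
            (hin _ hmem (hiff.1 hyS))
        · rw [Set.indicator_of_notMem hyS, hout _ hmem (fun h => hyS (hiff.2 h))]
          simp
      · rw [avgPotential_eq_zero hy.le]
        simpa using Set.indicator_nonneg (fun _ _ => hB) y
    rw [integral_indicator_const _ hSm, smul_eq_mul] at hint
    rw [norm_mul, Real.norm_of_nonneg hσ0]
    calc σ * ‖∫ y, avgPotential y * coordLaplacian v (x + σ • y)‖
        ≤ σ * (2 ^ Fintype.card ι * (η / σ) * B) := by
          gcongr
          exact hint.trans (by gcongr)
      _ = 2 ^ Fintype.card ι * η * B := by field_simp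

theorem fderiv_coord_comp_mul {f : ℝ → ℝ} (hf : Differentiable ℝ f)
    {g : EuclideanSpace ℝ ι → ℝ} (hg : Differentiable ℝ g) (j i : ι) (z : EuclideanSpace ℝ ι) :
    fderiv ℝ (fun y => f (y j) * g y) z (EuclideanSpace.single i (1 : ℝ))
      = (if i = j then deriv f (z j) else 0) * g z
        + f (z j) * fderiv ℝ g z (EuclideanSpace.single i (1 : ℝ)) := by
  have h1 : HasFDerivAt (fun y : EuclideanSpace ℝ ι => f (y j))
      (deriv f (z j) • EuclideanSpace.proj j) z :=
    (hf (z j)).hasDerivAt.comp_hasFDerivAt z (EuclideanSpace.proj (𝕜 := ℝ) j).hasFDerivAt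
  have h2 : fderiv ℝ (fun y => f (y j) * g y) z = _ := (h1.mul (hg z).hasFDerivAt).fderiv
  rw [h2]
  by_cases hij : i = j
  · subst hij; simp; ring
  · simp [hij, Ne.symm hij]

theorem coordLaplacian_coord_comp_mul {f : ℝ → ℝ} (hf : ContDiff ℝ 2 f)
    {u : EuclideanSpace ℝ ι → ℝ} (hu : ContDiff ℝ 2 u) (j : ι) (z : EuclideanSpace ℝ ι) :
    coordLaplacian (fun y => f (y j) * u y) z
      = deriv (deriv f) (z j) * u z
        + 2 * deriv f (z j) * fderiv ℝ u z (EuclideanSpace.single j (1 : ℝ))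
        + f (z j) * coordLaplacian u z := by
  have hf1 : Differentiable ℝ f := hf.differentiable two_ne_zero
  have hu1 : Differentiable ℝ u := hu.differentiable two_ne_zero
  have hf2 : Differentiable ℝ (deriv f) :=
    ((contDiff_succ_iff_deriv (n := 1)).1 (by simpa [one_add_one_eq_two] using hf)).2.2.differentiable
      one_ne_zero
  have hg (i : ι) : Differentiable ℝ fun y => fderiv ℝ u y (EuclideanSpace.single i (1 : ℝ)) :=
    (hu.fderiv_two_apply_const _).differentiable one_ne_zero
  have hproj : Differentiable ℝ fun y : EuclideanSpace ℝ ι => y j :=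
    (EuclideanSpace.proj (𝕜 := ℝ) j).differentiable
  have hterm : ∀ i, fderiv ℝ (fun y => fderiv ℝ (fun y => f (y j) * u y) y
        (EuclideanSpace.single i (1 : ℝ))) z (EuclideanSpace.single i (1 : ℝ))
      = (if i = j then deriv (deriv f) (z j) * u z
          + 2 * deriv f (z j) * fderiv ℝ u z (EuclideanSpace.single j (1 : ℝ)) else 0)
        + f (z j) * fderiv ℝ (fun y => fderiv ℝ u y (EuclideanSpace.single i (1 : ℝ))) z
          (EuclideanSpace.single i (1 : ℝ)) := by
    intro i
    simp only [fderiv_coord_comp_mul hf1 hu1]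
    by_cases hij : i = j
    · subst hij
      simp only [if_true]
      rw [fderiv_fun_add, add_apply, fderiv_coord_comp_mul hf2 hu1,
        fderiv_coord_comp_mul hf1 (hg i)]
      · simp only [if_true]; ring
      · exact ((hf2.comp hproj).mul hu1) z
      · exact ((hf1.comp hproj).mul (hg i)) z
    · simp only [if_neg hij, zero_mul, zero_add]
      rw [fderiv_coord_comp_mul hf1 (hg i)]
      simp [hij]
  unfold coordLaplacian
  rw [Finset.sum_congr rfl fun i _ => hterm i, Finset.sum_add_distrib, Finset.mul_sum]
  simp

end Slab

theorem exists_bound_deriv_smoothTransition :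
    ∃ K : ℝ, 0 ≤ K ∧ (∀ t, |deriv Real.smoothTransition t| ≤ K) ∧
      ∀ t, |deriv (deriv Real.smoothTransition) t| ≤ K := by
  have hs : ContDiff ℝ 2 Real.smoothTransition := Real.smoothTransition.contDiff
  have hs1 : ContDiff ℝ 1 (deriv Real.smoothTransition) :=
    ((contDiff_succ_iff_deriv (n := 1)).1 (by simpa [one_add_one_eq_two] using hs)).2.2
  have hcs : HasCompactSupport (deriv Real.smoothTransition) := by
    refine HasCompactSupport.intro (isCompact_Icc (a := (0 : ℝ)) (b := 1)) fun t ht => ?_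
    rcases lt_or_ge t 0 with h | h
    · have : Real.smoothTransition =ᶠ[nhds t] fun _ => 0 := by
        filter_upwards [gt_mem_nhds h] with r hr
        exact Real.smoothTransition.zero_of_nonpos hr.le
      rw [this.deriv_eq, deriv_const]
    · have h1 : 1 < t := not_le.1 fun h' => ht ⟨h, h'⟩
      have : Real.smoothTransition =ᶠ[nhds t] fun _ => 1 := by
        filter_upwards [lt_mem_nhds h1] with r hr
        exact Real.smoothTransition.one_of_one_le hr.le
      rw [this.deriv_eq, deriv_const]
  obtain ⟨K₁, hK₁⟩ := hcs.exists_bound_of_continuous hs1.continuous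
  obtain ⟨K₂, hK₂⟩ := hcs.deriv.exists_bound_of_continuous (hs1.continuous_deriv le_rfl)
  exact ⟨max K₁ K₂, (abs_nonneg _).trans ((hK₁ 0).trans (le_max_left _ _)),
    fun t => (hK₁ t).trans (le_max_left _ _), fun t => (hK₂ t).trans (le_max_right _ _)⟩

section HalfSpace

variable {ι : Type*}

/-- The extension by zero of `u` from the half-space `{z j > 0}`. -/
noncomputable def upperPart (j : ι) (u : EuclideanSpace ℝ ι → ℝ) (z : EuclideanSpace ℝ ι) : ℝ :=
  if z j ≤ 0 then 0 else u z

theorem continuous_upperPart (j : ι) {u : EuclideanSpace ℝ ι → ℝ} (hu : Continuous u)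
    (h0 : ∀ z, z j = 0 → u z = 0) : Continuous (upperPart j u) :=
  Continuous.if_le continuous_const hu (by fun_prop) continuous_const fun z hz => (h0 z hz).symm

variable [Fintype ι] [DecidableEq ι]

theorem norm_sub_smul_single_le (j : ι) (z : EuclideanSpace ℝ ι) {a : ℝ} (ha : 0 ≤ a)
    (haz : a ≤ z j) : ‖z - a • EuclideanSpace.single j (1 : ℝ)‖ ≤ ‖z‖ := by
  refine le_of_sq_le_sq ?_ (norm_nonneg _)
  rw [norm_sub_sq_real, inner_smul_right, EuclideanSpace.inner_single_right, norm_smul]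
  simp only [conj_trivial, one_mul, PiLp.norm_single, norm_one, mul_one,
    Real.norm_eq_abs, sq_abs]
  nlinarith

theorem exists_abs_le_near_hyperplane (j : ι) {u : EuclideanSpace ℝ ι → ℝ}
    (hu : ContDiff ℝ 2 u) (h0 : ∀ z, z j = 0 → u z = 0) {ε : ℝ}
    (hε : ∀ z ∈ ball (0 : EuclideanSpace ℝ ι) 1, z j = 0 →
      |fderiv ℝ u z (EuclideanSpace.single j (1 : ℝ))| ≤ ε) :
    ∃ L : ℝ, 0 ≤ L ∧ ∀ z ∈ ball (0 : EuclideanSpace ℝ ι) 1, 0 ≤ z j →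
      |fderiv ℝ u z (EuclideanSpace.single j (1 : ℝ))| ≤ ε + L * z j ∧
        |u z| ≤ (ε + L * z j) * z j := by
  set e : EuclideanSpace ℝ ι := EuclideanSpace.single j (1 : ℝ) with he
  have hej : e j = 1 := by simp [he]
  have hg : ContDiff ℝ 1 fun y => fderiv ℝ u y e := hu.fderiv_two_apply_const e
  obtain ⟨L, hL⟩ := (isCompact_closedBall (0 : EuclideanSpace ℝ ι) 1).exists_bound_of_continuousOn
    (hg.continuous_fderiv one_ne_zero).continuousOn
  have hL0 : 0 ≤ L := (norm_nonneg _).trans (hL 0 (mem_closedBall_self zero_le_one))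
  have hfoot : ∀ z ∈ ball (0 : EuclideanSpace ℝ ι) 1, ∀ a, 0 ≤ a → a ≤ z j →
      z - a • e ∈ ball (0 : EuclideanSpace ℝ ι) 1 := by
    intro z hz a ha haz
    rw [mem_ball_zero_iff] at hz ⊢
    exact (norm_sub_smul_single_le j z ha haz).trans_lt hz
  have hder : ∀ z ∈ ball (0 : EuclideanSpace ℝ ι) 1, 0 ≤ z j →
      |fderiv ℝ u z e| ≤ ε + L * z j := by
    intro z hz hzj
    have h1 := hfoot z hz (z j) hzj le_rfl
    have h2 := (convex_closedBall (0 : EuclideanSpace ℝ ι) 1).norm_image_sub_le_of_norm_fderiv_le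
      (f := fun y => fderiv ℝ u y e) (fun y _ => hg.differentiable one_ne_zero y) hL
      (ball_subset_closedBall h1) (ball_subset_closedBall hz)
    have h3 : ‖z - (z - z j • e)‖ = z j := by
      rw [sub_sub_cancel, norm_smul, Real.norm_of_nonneg hzj]
      simp [he]
    rw [h3] at h2
    have h4 := hε _ h1 (by simp [hej])
    have h5 : |fderiv ℝ u z e| ≤ |fderiv ℝ u z e - fderiv ℝ u (z - z j • e) e|
        + |fderiv ℝ u (z - z j • e) e| := by
      simpa using abs_add_le (fderiv ℝ u z e - fderiv ℝ u (z - z j • e) e)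
        (fderiv ℝ u (z - z j • e) e)
    rw [Real.norm_eq_abs] at h2
    linarith
  refine ⟨L, hL0, fun z hz hzj => ⟨hder z hz hzj, ?_⟩⟩
  set γ : ℝ → EuclideanSpace ℝ ι := fun τ => z - (z j - τ) • e with hγ
  have hγd : ∀ τ, HasDerivAt γ e τ := by
    intro τ
    have := (((hasDerivAt_id τ).const_sub (z j)).smul_const e).const_sub z
    simpa using this
  have hγj : ∀ τ, γ τ j = τ := by intro τ; simp [hγ, hej]
  have key := norm_image_sub_le_of_norm_deriv_le_segment' (f := fun τ => u (γ τ))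
    (a := 0) (b := z j) (C := ε + L * z j)
    (fun τ _ => ((hu.differentiable two_ne_zero (γ τ)).hasFDerivAt.comp_hasDerivAt τ
      (hγd τ)).hasDerivWithinAt) ?_ (z j) ⟨hzj, le_rfl⟩
  · have h1 : γ (z j) = z := by simp [hγ]
    rw [h1, h0 (γ 0) (hγj 0), sub_zero, sub_zero] at key
    exact key
  · rintro τ ⟨hτ0, hτ⟩
    refine (hder (γ τ) (hfoot z hz _ (by linarith) (by linarith)) (by rw [hγj]; exact hτ0)).trans ?_
    rw [hγj]
    gcongr

theorem exists_ballAvg_upperPart_bound (j : ι) :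
    ∃ K : ℝ, 0 ≤ K ∧ ∀ u : EuclideanSpace ℝ ι → ℝ, ContDiff ℝ 2 u →
      (∀ z ∈ ball (0 : EuclideanSpace ℝ ι) 1, coordLaplacian u z = 0) →
      (∀ z, z j = 0 → u z = 0) →
      ∀ ε, 0 ≤ ε → (∀ z ∈ ball (0 : EuclideanSpace ℝ ι) 1, z j = 0 →
        |fderiv ℝ u z (EuclideanSpace.single j (1 : ℝ))| ≤ ε) →
      ∀ (x : EuclideanSpace ℝ ι) (ρ : ℝ), 0 ≤ ρ →
        closedBall x ρ ⊆ ball (0 : EuclideanSpace ℝ ι) 1 →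
        |ballAvg ρ (upperPart j u) x
          - (∫ y : EuclideanSpace ℝ ι, avgKernel y) * upperPart j u x| ≤ K * ε * ρ := by
  obtain ⟨K, hK0, hK1, hK2⟩ := exists_bound_deriv_smoothTransition
  refine ⟨2 ^ Fintype.card ι * (3 * K), by positivity, fun u hu hlap h0 ε hε0 hε x ρ hρ hsub => ?_⟩
  obtain ⟨L, hL0, hL⟩ := exists_abs_le_near_hyperplane j hu h0 hε
  set c := ∫ y : EuclideanSpace ℝ ι, avgKernel y with hc
  have hc0 : 0 < c := integral_avgKernel_pos
  have hcu : Continuous (upperPart j u) := continuous_upperPart j hu.continuous h0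
  have hbound : ∀ η : ℝ, 0 < η → |ballAvg ρ (upperPart j u) x - c * upperPart j u x|
      ≤ 2 ^ Fintype.card ι * (3 * K) * (ε + L * η) * ρ + 2 * c * ((ε + L * η) * η) := by
    intro η hη
    set s : ℝ → ℝ := fun t => Real.smoothTransition (η⁻¹ * t) with hs
    have hsC : ContDiff ℝ 2 s :=
      Real.smoothTransition.contDiff.comp (contDiff_const.mul contDiff_id)
    have hs1 : deriv s = fun t => η⁻¹ * deriv Real.smoothTransition (η⁻¹ * t) := by
      ext t; simp [hs, deriv_comp_mul_left]
    have hs2 : deriv (deriv s)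
        = fun t => η⁻¹ * (η⁻¹ * deriv (deriv Real.smoothTransition) (η⁻¹ * t)) := by
      rw [hs1]; ext t; simp [deriv_comp_mul_left]
    set v : EuclideanSpace ℝ ι → ℝ := fun y => s (y j) * u y with hv
    have hsz : ContDiff ℝ 2 fun y : EuclideanSpace ℝ ι => s (y j) :=
      hsC.comp (EuclideanSpace.proj (𝕜 := ℝ) j).contDiff
    have hvC : ContDiff ℝ 2 v := hsz.mul hu
    have hclose : ∀ z ∈ ball (0 : EuclideanSpace ℝ ι) 1,
        |upperPart j u z - v z| ≤ (ε + L * η) * η := by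
      intro z hz
      have hnn : 0 ≤ (ε + L * η) * η := by positivity
      rcases le_or_gt (z j) 0 with h | h
      · have : Real.smoothTransition (η⁻¹ * z j) = 0 :=
          Real.smoothTransition.zero_of_nonpos
            (mul_nonpos_of_nonneg_of_nonpos (inv_nonneg.2 hη.le) h)
        simpa [upperPart, h, hv, hs, this] using hnn
      · rcases le_total η (z j) with h' | h'
        · have : Real.smoothTransition (η⁻¹ * z j) = 1 := by
            apply Real.smoothTransition.one_of_one_le
            rw [inv_mul_eq_div, le_div_iff₀ hη]; linarith
          simpa [upperPart, h.not_ge, hv, hs, this] using hnn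
        · have h1 := Real.smoothTransition.nonneg (η⁻¹ * z j)
          have h2 := Real.smoothTransition.le_one (η⁻¹ * z j)
          have h3 : upperPart j u z - v z = (1 - Real.smoothTransition (η⁻¹ * z j)) * u z := by
            simp only [upperPart, h.not_ge, hv, hs, if_false]; ring
          rw [h3, abs_mul, abs_of_nonneg (by linarith)]
          calc (1 - Real.smoothTransition (η⁻¹ * z j)) * |u z| ≤ |u z| :=
                mul_le_of_le_one_left (abs_nonneg _) (by linarith)
            _ ≤ (ε + L * z j) * z j := (hL z hz h.le).2
            _ ≤ (ε + L * η) * η := by gcongr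
    have hlapv : ∀ z ∈ closedBall x ρ, z j ∈ Set.Icc 0 η →
        |coordLaplacian v z| ≤ 3 * K * (ε + L * η) / η := by
      rintro z hz ⟨hz0, hzη⟩
      obtain ⟨hd, hu'⟩ := hL z (hsub hz) hz0
      have hd' : |fderiv ℝ u z (EuclideanSpace.single j (1 : ℝ))| ≤ ε + L * η :=
        hd.trans (by gcongr)
      have hu'' : |u z| ≤ (ε + L * η) * η := hu'.trans (by gcongr)
      rw [hv, coordLaplacian_coord_comp_mul hsC hu, hlap z (hsub hz), mul_zero, add_zero, hs2, hs1]
      refine (abs_add_le _ _).trans ?_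
      simp only [abs_mul, abs_of_pos (inv_pos.2 hη), abs_two]
      calc η⁻¹ * (η⁻¹ * |deriv (deriv Real.smoothTransition) (η⁻¹ * z j)|) * |u z|
            + 2 * (η⁻¹ * |deriv Real.smoothTransition (η⁻¹ * z j)|)
              * |fderiv ℝ u z (EuclideanSpace.single j (1 : ℝ))|
          ≤ η⁻¹ * (η⁻¹ * K) * ((ε + L * η) * η) + 2 * (η⁻¹ * K) * (ε + L * η) := by
            gcongr
            · exact hK2 _
            · exact hK1 _
        _ = 3 * K * (ε + L * η) / η := by field_simp; ring
    have hlapv0 : ∀ z ∈ closedBall x ρ, z j ∉ Set.Icc 0 η → coordLaplacian v z = 0 := by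
      intro z hz hzj
      have hconst : ∃ a : ℝ, s =ᶠ[nhds (z j)] fun _ => a := by
        rcases lt_or_ge (z j) 0 with h | h
        · refine ⟨0, ?_⟩
          filter_upwards [gt_mem_nhds h] with t ht
          exact Real.smoothTransition.zero_of_nonpos
            (mul_nonpos_of_nonneg_of_nonpos (inv_nonneg.2 hη.le) ht.le)
        · have h1 : η < z j := not_le.1 fun h' => hzj ⟨h, h'⟩
          refine ⟨1, ?_⟩
          filter_upwards [lt_mem_nhds h1] with t ht
          apply Real.smoothTransition.one_of_one_le
          rw [inv_mul_eq_div, le_div_iff₀ hη]; linarith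
      obtain ⟨a, ha⟩ := hconst
      have hd1 : deriv s =ᶠ[nhds (z j)] fun _ => 0 := by
        filter_upwards [ha.deriv] with t ht
        rw [ht, deriv_const]
      rw [hv, coordLaplacian_coord_comp_mul hsC hu, hlap z (hsub hz), hd1.deriv_eq, hd1.eq_of_nhds]
      simp
    have hmain := abs_ballAvg_sub_le_of_laplacian_slab hvC j hρ hη.le (by positivity) hlapv hlapv0
    have hcong := abs_ballAvg_sub_le hcu hvC.continuous hρ fun z hz => hclose z (hsub hz)
    have hpt := hclose x (hsub (mem_closedBall_self hρ))
    have hpt' : |c * v x - c * upperPart j u x| ≤ c * ((ε + L * η) * η) := by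
      rw [← mul_sub, abs_mul, abs_of_pos hc0, abs_sub_comm]
      gcongr
    have hsplit : ballAvg ρ (upperPart j u) x - c * upperPart j u x
        = (ballAvg ρ (upperPart j u) x - ballAvg ρ v x) + (ballAvg ρ v x - c * v x)
          + (c * v x - c * upperPart j u x) := by ring
    rw [hsplit]
    refine (abs_add_three _ _ _).trans ?_
    have hB : 2 ^ Fintype.card ι * η * (3 * K * (ε + L * η) / η) * ρ
        = 2 ^ Fintype.card ι * (3 * K) * (ε + L * η) * ρ := by field_simp
    rw [hB] at hmain
    linarith
  have hlim : Filter.Tendsto (fun η : ℝ =>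
      2 ^ Fintype.card ι * (3 * K) * (ε + L * η) * ρ + 2 * c * ((ε + L * η) * η))
      (nhdsWithin 0 (Set.Ioi 0)) (nhds (2 ^ Fintype.card ι * (3 * K) * ε * ρ)) := by
    refine tendsto_nhdsWithin_of_tendsto_nhds ?_
    have : Continuous fun η : ℝ =>
      2 ^ Fintype.card ι * (3 * K) * (ε + L * η) * ρ + 2 * c * ((ε + L * η) * η) := by fun_prop
    simpa using this.tendsto 0
  exact ge_of_tendsto hlim (eventually_nhdsWithin_of_forall fun η hη => hbound η hη)

end HalfSpace

section Differences

theorem abs_iterate_fwdDiff_le {E : Type*} [AddCommGroup E] {f : E → ℝ} {h : E} {A : ℝ} (k : ℕ)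
    {y : E} (hf : ∀ i ≤ k, |f (y + i • h)| ≤ A) : |(fwdDiff h)^[k] f y| ≤ 2 ^ k * A := by
  induction k generalizing y with
  | zero => simpa using hf 0 le_rfl
  | succ k ih =>
    rw [Function.iterate_succ_apply', fwdDiff]
    have h1 := ih (y := y) fun i hi => hf i (hi.trans k.le_succ)
    have h2 := ih (y := y + h) fun i hi => by
      have := hf (i + 1) (Nat.succ_le_succ hi)
      rwa [succ_nsmul', ← add_assoc] at this
    calc |(fwdDiff h)^[k] f (y + h) - (fwdDiff h)^[k] f y|
        ≤ |(fwdDiff h)^[k] f (y + h)| + |(fwdDiff h)^[k] f y| := abs_sub _ _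
      _ ≤ 2 ^ (k + 1) * A := by rw [pow_succ]; linarith

theorem abs_extrapolate_le {E : Type*} [AddCommGroup E] {f : E → ℝ} {h x : E} {m : ℕ} {δ D : ℝ}
    (hδ : 0 ≤ δ) (hD : 0 ≤ D) (hf : ∀ i < m, |f (x + i • h)| ≤ δ)
    (hd : ∀ i ≤ m, |(fwdDiff h)^[m] f (x + i • h)| ≤ D) :
    |f (x + (2 * m) • h)| ≤ 9 ^ m * (δ + D / 2 ^ m) := by
  have hterm : ∀ k ∈ Finset.range (2 * m + 1), |(fwdDiff h)^[k] f x| ≤ 2 ^ k * (δ + D / 2 ^ m) := by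
    intro k hk
    rcases lt_or_ge k m with hkm | hkm
    · refine (abs_iterate_fwdDiff_le k fun i hi => hf i (hi.trans_lt hkm)).trans ?_
      gcongr
      exact le_add_of_nonneg_right (by positivity)
    · obtain ⟨l, rfl⟩ := Nat.exists_eq_add_of_le' hkm
      rw [Function.iterate_add_apply]
      refine (abs_iterate_fwdDiff_le l fun i hi => hd i ?_).trans ?_
      · have := Finset.mem_range.1 hk; omega
      · have : (2 : ℝ) ^ (l + m) * (δ + D / 2 ^ m) = 2 ^ l * D + 2 ^ (l + m) * δ := by
          rw [pow_add]; field_simp; ring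
        rw [this]
        exact le_add_of_nonneg_right (by positivity)
  rw [shift_eq_sum_fwdDiff_iter h f]
  have h9 : (9 : ℝ) ^ m = ∑ k ∈ Finset.range (2 * m + 1), 2 ^ k * ((2 * m).choose k : ℝ) := by
    have := add_pow (2 : ℝ) 1 (2 * m)
    simp only [one_pow, mul_one] at this
    rw [← this, pow_mul]; norm_num
  rw [h9, Finset.sum_mul]
  refine (Finset.abs_sum_le_sum_abs _ _).trans (Finset.sum_le_sum fun k hk => ?_)
  rw [nsmul_eq_mul, abs_mul, Nat.abs_cast, mul_comm (2 ^ k : ℝ), mul_assoc]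
  exact mul_le_mul_of_nonneg_left (hterm k hk) (Nat.cast_nonneg _)

variable (E : Type*) [NormedAddCommGroup E] [InnerProductSpace ℝ E] [FiniteDimensional ℝ E]
  [MeasurableSpace E] [BorelSpace E]

theorem exists_abs_ballAvg_translate_le :
    ∃ L : ℝ, 1 ≤ L ∧ ∀ (ρ : ℝ) (h : E), 0 < ρ → ‖h‖ ≤ ρ → ∀ v : E → ℝ, Continuous v →
      ∀ (M : ℝ) (y : E), (∀ z ∈ closedBall y (2 * ρ), |v z| ≤ M) →
        |ballAvg ρ v (y + h) - ballAvg ρ v y|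
          ≤ (∫ y : E, avgKernel y) * (L * ‖h‖ / ρ * M) := by
  set c := ∫ y : E, avgKernel y with hc
  have hc0 : 0 < c := integral_avgKernel_pos
  set V := volume.real (closedBall (0 : E) 2) with hV
  refine ⟨2 * V / c + 1, le_add_of_nonneg_left (by positivity), fun ρ h hρ hh v hv M y hM => ?_⟩
  have hM0 : 0 ≤ M := (abs_nonneg _).trans (hM y (mem_closedBall_self (by positivity)))
  set k : E := ρ⁻¹ • h with hk
  have hkn : ‖k‖ = ‖h‖ / ρ := by
    rw [hk, norm_smul, norm_inv, Real.norm_of_nonneg hρ.le, inv_mul_eq_div]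
  have hk1 : ‖k‖ ≤ 1 := by rw [hkn]; exact (div_le_one hρ).2 hh
  have hshift : ballAvg ρ v (y + h) = ∫ w, avgKernel (w - k) * v (y + ρ • w) := by
    rw [← integral_add_right_eq_self _ k]
    unfold ballAvg
    congr 1
    ext w
    rw [add_sub_cancel_right, smul_add, hk, smul_inv_smul₀ hρ.ne']
    congr 2
    abel
  have hi1 : Integrable fun w => avgKernel (w - k) * v (y + ρ • w) := by
    refine ((continuous_avgKernel.comp (continuous_sub_right k)).mul
      (hv.comp (by fun_prop))).integrable_of_hasCompactSupport ?_
    exact (hasCompactSupport_avgKernel.comp_homeomorph (Homeomorph.subRight k)).mul_right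
  have hi2 : Integrable fun w => avgKernel w * v (y + ρ • w) :=
    integrable_avgKernel_mul (hv.comp (by fun_prop))
  have hfin : volume (closedBall (0 : E) 2) ≠ ⊤ := measure_closedBall_lt_top.ne
  have hmain : ‖∫ w, (avgKernel (w - k) * v (y + ρ • w) - avgKernel w * v (y + ρ • w))‖
      ≤ ∫ w, (closedBall (0 : E) 2).indicator (fun _ => 2 * ‖k‖ * M) w := by
    refine norm_integral_le_of_norm_le ((integrable_indicator_iff measurableSet_closedBall).2
        (integrableOn_const hfin)) (Filter.Eventually.of_forall fun w => ?_)
    by_cases hw : w ∈ closedBall (0 : E) 2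
    · rw [Set.indicator_of_mem hw, ← sub_mul, norm_mul, Real.norm_eq_abs, Real.norm_eq_abs]
      have h1 := abs_avgKernel_sub_le (w - k) w
      rw [sub_sub_cancel_left, norm_neg] at h1
      refine mul_le_mul h1 (hM _ ?_) (abs_nonneg _) (by positivity)
      rw [mem_closedBall_zero_iff] at hw
      rw [mem_closedBall, dist_self_add_left, norm_smul, Real.norm_of_nonneg hρ.le]
      nlinarith
    · rw [Set.indicator_of_notMem hw]
      rw [mem_closedBall_zero_iff, not_le] at hw
      have h1 : 1 ≤ ‖w - k‖ := by linarith [norm_sub_norm_le w k]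
      rw [avgKernel_eq_zero h1, avgKernel_eq_zero (by linarith : 1 ≤ ‖w‖)]
      simp
  rw [integral_indicator_const _ measurableSet_closedBall, integral_sub hi1 hi2, ← hshift,
    smul_eq_mul, ← hV] at hmain
  refine hmain.trans ?_
  have : c * ((2 * V / c + 1) * ‖h‖ / ρ * M) = V * (2 * ‖k‖ * M) + c * (‖k‖ * M) := by
    rw [hkn]; field_simp
  rw [this]
  exact le_add_of_nonneg_right (by positivity)

theorem exists_abs_iterate_fwdDiff_le :
    ∃ L : ℝ, 1 ≤ L ∧ ∀ (ρ a : ℝ) (h : E), 0 < ρ → 0 ≤ a → a ≤ 1 → L * ‖h‖ ≤ a * ρ →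
      ∀ (k : ℕ) (v : E → ℝ), Continuous v → ∀ (M ε : ℝ) (x : E), 0 ≤ ε →
        (∀ y ∈ closedBall x (k * (2 * ρ)), |v y| ≤ M) →
        (∀ y ∈ closedBall x (k * (2 * ρ)),
          |ballAvg ρ v y - (∫ y : E, avgKernel y) * v y| ≤ (∫ y : E, avgKernel y) * ε) →
        |(fwdDiff h)^[k] v x| ≤ a ^ k * M + (2 ^ (k + 1) - 2) * ε := by
  obtain ⟨L, hL1, hL⟩ := exists_abs_ballAvg_translate_le E
  set c := ∫ y : E, avgKernel y with hc
  have hc0 : 0 < c := integral_avgKernel_pos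
  refine ⟨L, hL1, fun ρ a h hρ ha0 ha1 hLh k => ?_⟩
  have hhρ : ‖h‖ ≤ ρ := by nlinarith [norm_nonneg h]
  induction k with
  | zero =>
    intro v _ M ε x _ hM _
    simpa using hM x (by simp)
  | succ k ih =>
    intro v hv M ε x hε hM hdef
    have hM0 : 0 ≤ M := (abs_nonneg _).trans (hM x (mem_closedBall_self (by positivity)))
    have hball : ∀ y ∈ closedBall x (k * (2 * ρ)),
        closedBall y (2 * ρ) ⊆ closedBall x ((k + 1 : ℕ) * (2 * ρ)) := by
      intro y hy
      refine closedBall_subset_closedBall' ?_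
      rw [mem_closedBall] at hy
      push_cast
      linarith
    have hmem : ∀ y ∈ closedBall x (k * (2 * ρ)), y ∈ closedBall x ((k + 1 : ℕ) * (2 * ρ)) ∧
        y + h ∈ closedBall x ((k + 1 : ℕ) * (2 * ρ)) := by
      intro y hy
      refine ⟨hball y hy (mem_closedBall_self (by positivity)), hball y hy ?_⟩
      rw [mem_closedBall, dist_self_add_left]
      linarith
    have hvh : Continuous fun y => v (y + h) := hv.comp (by fun_prop)
    have hshift : ∀ y, ballAvg ρ (fwdDiff h v) y = ballAvg ρ v (y + h) - ballAvg ρ v y := by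
      intro y
      have h1 : Integrable fun z => avgKernel z * v (y + h + ρ • z) :=
        integrable_avgKernel_mul (hv.comp (by fun_prop))
      have h2 : Integrable fun z => avgKernel z * v (y + ρ • z) :=
        integrable_avgKernel_mul (hv.comp (by fun_prop))
      unfold ballAvg
      rw [← integral_sub h1 h2]
      congr 1
      ext z
      rw [fwdDiff, mul_sub, add_right_comm]
    have key := ih (fwdDiff h v) (hvh.sub hv) (a * M + 2 * ε) (2 * ε) x (by positivity) ?_ ?_
    · rw [Function.iterate_succ_apply]
      refine key.trans ?_
      have hak : a ^ k ≤ 1 := pow_le_one₀ ha0 ha1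
      have h1 : a ^ k * (2 * ε) ≤ 1 * (2 * ε) := by gcongr
      calc a ^ k * (a * M + 2 * ε) + (2 ^ (k + 1) - 2) * (2 * ε)
          = a ^ (k + 1) * M + a ^ k * (2 * ε) + (2 ^ (k + 1) - 2) * (2 * ε) := by ring
        _ ≤ a ^ (k + 1) * M + 1 * (2 * ε) + (2 ^ (k + 1) - 2) * (2 * ε) := by gcongr
        _ = a ^ (k + 1) * M + (2 ^ (k + 1 + 1) - 2) * ε := by ring
    · intro y hy
      obtain ⟨hy1, hy2⟩ := hmem y hy
      have h1 := hL ρ h hρ hhρ v hv M y fun z hz => hM z (hball y hy hz)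
      have h2 := hdef y hy1
      have h3 := hdef (y + h) hy2
      have h4 : L * ‖h‖ / ρ * M ≤ a * M :=
        mul_le_mul_of_nonneg_right ((div_le_iff₀ hρ).2 hLh) hM0
      have h5 : c * (v (y + h) - v y) = (ballAvg ρ v (y + h) - ballAvg ρ v y)
          + -(ballAvg ρ v (y + h) - c * v (y + h)) + (ballAvg ρ v y - c * v y) := by ring
      have h6 : c * |v (y + h) - v y| ≤ c * (a * M + 2 * ε) := by
        rw [← abs_of_pos hc0, ← abs_mul, abs_of_pos hc0, h5]
        refine (abs_add_three _ _ _).trans ?_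
        rw [abs_neg]
        have := mul_le_mul_of_nonneg_left h4 hc0.le
        linarith
      exact le_of_mul_le_mul_left h6 hc0
    · intro y hy
      obtain ⟨hy1, hy2⟩ := hmem y hy
      rw [hshift, fwdDiff]
      have h5 : ballAvg ρ v (y + h) - ballAvg ρ v y - c * (v (y + h) - v y)
          = (ballAvg ρ v (y + h) - c * v (y + h)) - (ballAvg ρ v y - c * v y) := by ring
      rw [h5]
      refine (abs_sub _ _).trans ?_
      linarith [hdef y hy1, hdef (y + h) hy2]

theorem exists_abs_le_of_small_on_ball :
    ∃ κ : ℝ, 0 < κ ∧ κ ≤ 1 / 9 ∧ ∀ (R : ℝ) (v : E → ℝ) (p : E) (M ε δ : ℝ), 0 < R →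
      Continuous v → 0 ≤ ε →
      (∀ y ∈ closedBall p (3 * R), |v y| ≤ M) →
      (∀ ρ, 0 < ρ → ρ ≤ R → ∀ y ∈ closedBall p (3 * R),
        |ballAvg ρ v y - (∫ y : E, avgKernel y) * v y| ≤ (∫ y : E, avgKernel y) * ε) →
      (∀ y ∈ closedBall p (κ * R), |v y| ≤ δ) →
      ∀ m : ℕ, 0 < m → ∀ z ∈ closedBall p (2 * (κ * R)),
        |v z| ≤ 9 ^ m * (δ + 2 * ε) + (1 / 2) ^ m * M := by
  obtain ⟨L, hL1, hL⟩ := exists_abs_iterate_fwdDiff_le E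
  have hL0 : 0 < L := one_pos.trans_le hL1
  have hκ : 1 / (9 * L) ≤ 1 / 9 := one_div_le_one_div_of_le (by norm_num) (by linarith)
  refine ⟨1 / (9 * L), by positivity, hκ, fun R v p M ε δ hR hv hε hM hdef hδ m hm z hz => ?_⟩
  set κ := 1 / (9 * L) with hκdef
  have hκ0 : 0 < κ := by positivity
  have hm0 : (0 : ℝ) < m := by exact_mod_cast hm
  set h : E := (2 * m : ℝ)⁻¹ • (z - p) with hh
  have hmh : (m : ℝ) * ‖h‖ ≤ κ * R := by
    rw [hh, norm_smul, norm_inv, Real.norm_of_nonneg (by positivity)]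
    rw [mem_closedBall, dist_eq_norm] at hz
    have : (m : ℝ) * ((2 * (m : ℝ))⁻¹ * ‖z - p‖) = ‖z - p‖ / 2 := by field_simp
    rw [this]; linarith
  have hi : ∀ i : ℕ, i ≤ m → dist (p + i • h) p ≤ κ * R := by
    intro i him
    rw [dist_self_add_left, ← Nat.cast_smul_eq_nsmul ℝ, norm_smul, Real.norm_natCast]
    refine le_trans ?_ hmh
    gcongr
  have hδ0 : 0 ≤ δ := (abs_nonneg _).trans (hδ p (mem_closedBall_self (by positivity)))
  have hM0 : 0 ≤ M := (abs_nonneg _).trans (hM p (mem_closedBall_self (by positivity)))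
  have hz' : z = p + (2 * m) • h := by
    rw [← Nat.cast_smul_eq_nsmul ℝ, hh]
    push_cast
    rw [smul_inv_smul₀ (by positivity)]
    abel
  have hsub : ∀ i : ℕ, i ≤ m →
      closedBall (p + i • h) (m * (2 * (R / m))) ⊆ closedBall p (3 * R) := by
    intro i him
    refine closedBall_subset_closedBall' ?_
    have h1 : (m : ℝ) * (2 * (R / m)) = 2 * R := by field_simp
    rw [h1]
    nlinarith [hi i him]
  have hdiff : ∀ i ≤ m, |(fwdDiff h)^[m] v (p + i • h)|
      ≤ (1 / 9) ^ m * M + (2 ^ (m + 1) - 2) * ε := by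
    intro i him
    refine hL (R / m) (1 / 9) h (by positivity) (by norm_num) (by norm_num) ?_ m v hv M ε _ hε
      (fun y hy => hM y (hsub i him hy)) (fun y hy => hdef _ (by positivity) ?_ y (hsub i him hy))
    · rw [mul_div_assoc', le_div_iff₀ hm0]
      calc L * ‖h‖ * m = L * (m * ‖h‖) := by ring
        _ ≤ L * (κ * R) := by gcongr
        _ = 1 / 9 * R := by rw [hκdef]; field_simp
    · exact div_le_self hR.le (by exact_mod_cast hm)
  have h2m : (2 : ℝ) ≤ 2 ^ (m + 1) := by
    rw [pow_succ]; linarith [one_le_pow₀ (M₀ := ℝ) one_le_two (n := m)]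
  have key := abs_extrapolate_le (f := v) (h := h) (x := p) (m := m) hδ0
    (add_nonneg (by positivity) (mul_nonneg (by linarith) hε))
    (fun i him => hδ _ (hi i him.le)) hdiff
  rw [← hz'] at key
  refine key.trans ?_
  have h9 : (9 : ℝ) ^ m * (((1 / 9) ^ m * M) / 2 ^ m) = (1 / 2) ^ m * M := by
    rw [div_pow, div_pow, one_pow]; field_simp
  have h2 : ((2 : ℝ) ^ (m + 1) - 2) * ε / 2 ^ m ≤ 2 * ε := by
    rw [div_le_iff₀ (by positivity), pow_succ]
    nlinarith
  calc (9 : ℝ) ^ m * (δ + ((1 / 9) ^ m * M + (2 ^ (m + 1) - 2) * ε) / 2 ^ m)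
      = 9 ^ m * (δ + (2 ^ (m + 1) - 2) * ε / 2 ^ m) + 9 ^ m * (((1 / 9) ^ m * M) / 2 ^ m) := by
        ring
    _ ≤ 9 ^ m * (δ + 2 * ε) + (1 / 2) ^ m * M := by
        rw [h9]; gcongr

end Differences

theorem le_rpow_mul_rpow_of_forall_pow {X e M : ℝ} (he : 0 ≤ e) (hM : 0 ≤ M) (hXM : X ≤ M)
    (h : ∀ m : ℕ, 0 < m → X ≤ 9 ^ m * e + (1 / 2) ^ m * M) :
    X ≤ 10 * e ^ (Real.log 2 / Real.log 18) * M ^ (1 - Real.log 2 / Real.log 18) := by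
  set β := Real.log 2 / Real.log 18 with hβ
  have hl2 : 0 < Real.log 2 := Real.log_pos (by norm_num)
  have hl18 : 0 < Real.log 18 := Real.log_pos (by norm_num)
  have hβ0 : 0 < β := by positivity
  rcases he.eq_or_lt with rfl | he
  · rw [Real.zero_rpow hβ0.ne', mul_zero, zero_mul]
    have hlim : Filter.Tendsto (fun m : ℕ => (1 / 2 : ℝ) ^ m * M) Filter.atTop (nhds (0 * M)) :=
      (tendsto_pow_atTop_nhds_zero_of_lt_one (by norm_num) (by norm_num)).mul_const M
    rw [zero_mul] at hlim
    refine ge_of_tendsto hlim (Filter.eventually_atTop.2 ⟨1, fun m hm => ?_⟩)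
    simpa using h m hm
  rcases hM.eq_or_lt with rfl | hM
  · exact hXM.trans (by positivity)
  have hprod : M ^ β * M ^ (1 - β) = M := by
    rw [← Real.rpow_add hM, add_sub_cancel, Real.rpow_one]
  rcases le_or_gt M e with hMe | heM
  · have h1 : M ^ β ≤ e ^ β := Real.rpow_le_rpow hM.le hMe hβ0.le
    calc X ≤ M ^ β * M ^ (1 - β) := by rw [hprod]; exact hXM
      _ ≤ e ^ β * M ^ (1 - β) := by gcongr
      _ ≤ 10 * (e ^ β * M ^ (1 - β)) := le_mul_of_one_le_left (by positivity) (by norm_num)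
      _ = 10 * e ^ β * M ^ (1 - β) := by ring
  · set l := Real.log (M / e) / Real.log 18 with hl
    have hl0 : 0 < l := div_pos (Real.log_pos ((one_lt_div he).2 heM)) hl18
    have h18 : (18 : ℝ) ^ l = M / e := by
      rw [Real.rpow_def_of_pos (by norm_num), hl, mul_div_cancel₀ _ hl18.ne',
        Real.exp_log (by positivity)]
    have h2 : (1 / 2 : ℝ) ^ l = (e / M) ^ β := by
      rw [Real.rpow_def_of_pos (by norm_num), Real.rpow_def_of_pos (by positivity),
        ← inv_div M e, Real.log_inv, one_div, Real.log_inv, hl, hβ]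
      congr 1
      ring
    have h9 : (9 : ℝ) ^ l * e = (1 / 2) ^ l * M := by
      have : (9 : ℝ) ^ l = (1 / 2) ^ l * 18 ^ l := by
        rw [← Real.mul_rpow (by norm_num) (by norm_num)]; norm_num
      rw [this, h18]; field_simp
    have hm1 : (9 : ℝ) ^ ⌈l⌉₊ ≤ 9 * 9 ^ l := by
      rw [← Real.rpow_natCast, mul_comm, ← Real.rpow_add_one (by norm_num)]
      exact Real.rpow_le_rpow_of_exponent_le (by norm_num) (Nat.ceil_lt_add_one hl0.le).le
    have hm2 : (1 / 2 : ℝ) ^ ⌈l⌉₊ ≤ (1 / 2) ^ l := by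
      rw [← Real.rpow_natCast]
      exact Real.rpow_le_rpow_of_exponent_ge (by norm_num) (by norm_num) (Nat.le_ceil l)
    calc X ≤ 9 ^ ⌈l⌉₊ * e + (1 / 2) ^ ⌈l⌉₊ * M := h _ (Nat.ceil_pos.2 hl0)
      _ ≤ 9 * 9 ^ l * e + (1 / 2) ^ l * M := by gcongr
      _ = 10 * ((e / M) ^ β * M) := by rw [mul_assoc, h9, h2]; ring
      _ = 10 * ((e / M) ^ β * (M ^ β * M ^ (1 - β))) := by rw [hprod]
      _ = 10 * e ^ β * M ^ (1 - β) := by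
        rw [Real.div_rpow he.le hM.le]
        have : M ^ β ≠ 0 := by positivity
        field_simp

section Interpolation

theorem mul_rpow_mul_rpow_le {A e M C C' β γ : ℝ} (hA : 0 ≤ A) (he : 0 ≤ e) (hM : 0 ≤ M)
    (hC : 0 ≤ C) (hC' : 0 ≤ C') (hβ0 : 0 ≤ β) (hβ1 : β ≤ 1) (hγ1 : γ ≤ 1)
    (h : A ≤ C * e ^ γ * M ^ (1 - γ)) :
    C' * A ^ β * M ^ (1 - β) ≤ (C' * C ^ β) * e ^ (γ * β) * M ^ (1 - γ * β) := by
  have hexp : (1 - γ) * β + (1 - β) = 1 - γ * β := by ring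
  have h1 : M ^ (1 - γ * β) = (M ^ (1 - γ)) ^ β * M ^ (1 - β) := by
    rw [← hexp, Real.rpow_add_of_nonneg hM (mul_nonneg (by linarith) hβ0) (by linarith),
      Real.rpow_mul hM]
  calc C' * A ^ β * M ^ (1 - β)
      ≤ C' * (C * e ^ γ * M ^ (1 - γ)) ^ β * M ^ (1 - β) := by gcongr
    _ = (C' * C ^ β) * e ^ (γ * β) * M ^ (1 - γ * β) := by
      rw [h1, Real.mul_rpow (by positivity) (by positivity), Real.mul_rpow hC (by positivity),
        ← Real.rpow_mul he]
      ring

variable (E : Type*) [NormedAddCommGroup E] [InnerProductSpace ℝ E] [FiniteDimensional ℝ E]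
  [MeasurableSpace E] [BorelSpace E]

theorem exists_abs_le_rpow_of_small_on_ball :
    ∃ κ β : ℝ, 0 < κ ∧ κ ≤ 1 / 9 ∧ 0 < β ∧ β < 1 ∧
      ∀ (R : ℝ) (v : E → ℝ) (p : E) (M ε δ : ℝ), 0 < R →
      Continuous v → 0 ≤ ε →
      (∀ y ∈ closedBall p (3 * R), |v y| ≤ M) →
      (∀ ρ, 0 < ρ → ρ ≤ R → ∀ y ∈ closedBall p (3 * R),
        |ballAvg ρ v y - (∫ y : E, avgKernel y) * v y| ≤ (∫ y : E, avgKernel y) * ε) →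
      (∀ y ∈ closedBall p (κ * R), |v y| ≤ δ) →
      ∀ z ∈ closedBall p (2 * (κ * R)), |v z| ≤ 10 * (δ + 2 * ε) ^ β * M ^ (1 - β) := by
  obtain ⟨κ, hκ0, hκ, h⟩ := exists_abs_le_of_small_on_ball E
  refine ⟨κ, Real.log 2 / Real.log 18, hκ0, hκ,
    div_pos (Real.log_pos (by norm_num)) (Real.log_pos (by norm_num)),
    (div_lt_one (Real.log_pos (by norm_num))).2 (Real.log_lt_log (by norm_num) (by norm_num)),
    fun R v p M ε δ hR hv hε hM hdef hδ z hz => ?_⟩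
  have hδ0 : 0 ≤ δ := (abs_nonneg _).trans (hδ p (mem_closedBall_self (by positivity)))
  have hM0 : 0 ≤ M := (abs_nonneg _).trans (hM p (mem_closedBall_self (by positivity)))
  exact le_rpow_mul_rpow_of_forall_pow (by positivity) hM0
    (hM z (closedBall_subset_closedBall (by nlinarith) hz))
    fun m hm => h R v p M ε δ hR hv hε hM hdef hδ m hm z hz

theorem exists_abs_le_rpow_of_meanValue {a R₀ r : ℝ} (ha : 0 ≤ a) (haR : a < R₀) (hr : 0 < r) :
    ∃ β C : ℝ, 0 < β ∧ β < 1 ∧ 0 < C ∧ ∀ v : E → ℝ, Continuous v →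
      ∀ M, (∀ y ∈ ball (0 : E) R₀, |v y| ≤ M) →
      (∀ x ρ, 0 ≤ ρ → closedBall x ρ ⊆ ball (0 : E) R₀ →
        ballAvg ρ v x = (∫ y : E, avgKernel y) * v x) →
      ∀ q : E, ‖q‖ ≤ a → ∀ δ, (∀ y ∈ closedBall q r, |v y| ≤ δ) →
      ∀ z : E, ‖z‖ ≤ a → |v z| ≤ C * δ ^ β * M ^ (1 - β) := by
  obtain ⟨κ, β, hκ0, hκ, hβ0, hβ1, h⟩ := exists_abs_le_rpow_of_small_on_ball E
  set R := min (r / κ) ((R₀ - a) / 5) with hR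
  have hR0 : 0 < R := lt_min (by positivity) (by linarith)
  have hRr : κ * R ≤ r := by
    have : R ≤ r / κ := min_le_left _ _
    rwa [le_div_iff₀ hκ0, mul_comm] at this
  have hRa : a + 4 * R < R₀ := by
    have : R ≤ (R₀ - a) / 5 := min_le_right _ _
    linarith
  set N := ⌈2 * a / (κ * R)⌉₊ + 1 with hN
  have hN0 : (0 : ℝ) < N := by positivity
  have hNa : 2 * a ≤ N * (κ * R) := by
    rw [← div_le_iff₀ (by positivity)]
    refine (Nat.le_ceil _).trans ?_
    rw [hN]; push_cast; linarith
  refine ⟨β ^ N, 10 ^ N, by positivity, pow_lt_one₀ hβ0.le hβ1 (by omega), by positivity,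
    fun v hv M hM hmv q hq δ hδ z hz => ?_⟩
  have hδ0 : 0 ≤ δ := (abs_nonneg _).trans (hδ q (mem_closedBall_self hr.le))
  have hM0 : 0 ≤ M := (abs_nonneg _).trans (hM 0 (mem_ball_self (by linarith)))
  set p : ℕ → E := fun i => q + ((i : ℝ) / N) • (z - q) with hp
  have hpa : ∀ i ≤ N, ‖p i‖ ≤ a := by
    intro i hi
    have h1 : (i : ℝ) / N ∈ Set.Icc (0 : ℝ) 1 :=
      ⟨by positivity, (div_le_one hN0).2 (by exact_mod_cast hi)⟩
    have := (convex_closedBall (0 : E) a).add_smul_sub_mem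
      (mem_closedBall_zero_iff.2 hq) (mem_closedBall_zero_iff.2 hz) h1
    exact mem_closedBall_zero_iff.1 this
  have hstep : ∀ i, dist (p (i + 1)) (p i) ≤ κ * R := by
    intro i
    have h1 : p (i + 1) - p i = (N : ℝ)⁻¹ • (z - q) := by
      simp only [hp]
      rw [add_sub_add_left_eq_sub, ← sub_smul]
      congr 1
      push_cast
      ring
    rw [dist_eq_norm, h1, norm_smul, norm_inv, Real.norm_natCast, inv_mul_le_iff₀ hN0]
    exact (norm_sub_le _ _).trans (by linarith)
  have hind : ∀ i ≤ N, ∀ y ∈ closedBall (p i) (κ * R),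
      |v y| ≤ 10 ^ i * δ ^ (β ^ i) * M ^ (1 - β ^ i) := by
    intro i
    induction i with
    | zero =>
      intro _ y hy
      simpa using hδ y (closedBall_subset_closedBall hRr (by simpa [hp] using hy))
    | succ i ih =>
      intro hi y hy
      have hi' : i ≤ N := (Nat.le_succ i).trans hi
      have hsub : ∀ y ∈ closedBall (p i) (3 * R), ∀ ρ ≤ R, closedBall y ρ ⊆ ball (0 : E) R₀ := by
        intro y hy ρ hρ w hw
        rw [mem_ball_zero_iff]
        rw [mem_closedBall, dist_eq_norm] at hy hw
        have h1 : ‖w‖ ≤ ‖w - y‖ + ‖y - p i‖ + ‖p i‖ := by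
          have := norm_add₃_le (a := w - y) (b := y - p i) (c := p i)
          rwa [sub_add_sub_cancel, sub_add_cancel] at this
        linarith [hpa i hi']
      have key := h R v (p i) M 0 _ hR0 hv le_rfl
        (fun y hy => hM y (hsub y hy 0 hR0.le (mem_closedBall_self le_rfl)))
        (fun ρ hρ hρR y hy => by rw [hmv y ρ hρ.le (hsub y hy ρ hρR)]; simp)
        (ih hi') y (closedBall_subset_closedBall' (by linarith [hstep i]) hy)
      rw [mul_zero, add_zero] at key
      refine key.trans ((mul_rpow_mul_rpow_le (by positivity) hδ0 hM0 (by positivity) (by norm_num)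
        hβ0.le hβ1.le (pow_le_one₀ hβ0.le hβ1.le) le_rfl).trans ?_)
      rw [← pow_succ]
      have h10 : ((10 : ℝ) ^ i) ^ β ≤ 10 ^ i := by
        refine Real.rpow_le_self_of_one_le ?_ hβ1.le
        exact one_le_pow₀ (by norm_num)
      have : (10 : ℝ) * (10 ^ i) ^ β ≤ 10 ^ (i + 1) := by
        rw [pow_succ']; gcongr
      gcongr
  have hpN : p N = z := by
    simp only [hp]
    rw [div_self hN0.ne', one_smul, add_sub_cancel]
  exact hind N le_rfl z (by rw [hpN]; exact mem_closedBall_self (by positivity))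

end Interpolation

section Global

variable {ι : Type*} [Fintype ι] [DecidableEq ι]

theorem ballAvg_eq_of_coordLaplacian_eq_zero {v : EuclideanSpace ℝ ι → ℝ} (hv : ContDiff ℝ 2 v)
    (j : ι) {x : EuclideanSpace ℝ ι} {ρ : ℝ} (hρ : 0 ≤ ρ)
    (h : ∀ z ∈ closedBall x ρ, coordLaplacian v z = 0) :
    ballAvg ρ v x = (∫ y : EuclideanSpace ℝ ι, avgKernel y) * v x := by
  have := abs_ballAvg_sub_le_of_laplacian_slab hv j (η := 0) (B := 0) hρ le_rfl le_rfl
    (fun z hz _ => by rw [h z hz, abs_zero]) (fun z hz _ => h z hz)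
  rw [mul_zero, zero_mul] at this
  exact sub_eq_zero.1 (abs_nonpos_iff.1 this)

theorem exists_abs_le_rpow_of_contDiff (j : ι) {a R₀ : ℝ} (haR : a < R₀) (hR₀ : 1 < R₀) :
    ∃ β C : ℝ, 0 < β ∧ β < 1 ∧ 0 < C ∧ ∀ u : EuclideanSpace ℝ ι → ℝ, ContDiff ℝ 2 u →
      (∀ z ∈ ball (0 : EuclideanSpace ℝ ι) R₀, coordLaplacian u z = 0) →
      (∀ z, z j = 0 → u z = 0) →
      ∀ M, (∀ z ∈ ball (0 : EuclideanSpace ℝ ι) R₀, |u z| ≤ M) →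
      ∀ ε, 0 ≤ ε → (∀ z ∈ ball (0 : EuclideanSpace ℝ ι) 1, z j = 0 →
        |fderiv ℝ u z (EuclideanSpace.single j (1 : ℝ))| ≤ ε) →
      ∀ z : EuclideanSpace ℝ ι, ‖z‖ ≤ a → |u z| ≤ C * ε ^ β * M ^ (1 - β) := by
  obtain ⟨K, hK0, hK⟩ := exists_ballAvg_upperPart_bound j
  obtain ⟨κ, β, hκ0, hκ, hβ0, hβ1, h⟩ := exists_abs_le_rpow_of_small_on_ball (EuclideanSpace ℝ ι)
  set c := ∫ y : EuclideanSpace ℝ ι, avgKernel y with hc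
  have hc0 : 0 < c := integral_avgKernel_pos
  set r := κ * (1 / 5) with hr
  have hr0 : 0 < r := by positivity
  have hr1 : r ≤ 1 / 45 := by linarith
  set e : EuclideanSpace ℝ ι := EuclideanSpace.single j (1 : ℝ) with he
  have hen : ‖e‖ = 1 := by simp [he]
  have hej : e j = 1 := by simp [he]
  obtain ⟨γ, C, hγ0, hγ1, hC0, hchain⟩ := exists_abs_le_rpow_of_meanValue (EuclideanSpace ℝ ι)
    (a := max a 1) (R₀ := R₀) (r := r / 4) (zero_le_one.trans (le_max_right _ _))
    (max_lt haR hR₀) (by positivity)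
  set L := 2 * (K / c) + 1 with hL
  have hL0 : 0 < L := by positivity
  refine ⟨β * γ, C * (10 * L ^ β) ^ γ, by positivity,
    (mul_lt_of_lt_one_right hβ0 hγ1).trans hβ1, by positivity,
    fun u hu hlap h0 M hM ε hε hder z hz => ?_⟩
  have hM0 : 0 ≤ M := (abs_nonneg _).trans (hM 0 (mem_ball_self (by linarith)))
  have hsub1 : ball (0 : EuclideanSpace ℝ ι) 1 ⊆ ball 0 R₀ := ball_subset_ball hR₀.le
  have hpn : ‖-(r • e)‖ = r := by rw [norm_neg, norm_smul, hen, mul_one, Real.norm_of_nonneg hr0.le]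
  have hsub : ∀ y ∈ closedBall (-(r • e)) (3 * (1 / 5)), ∀ ρ ≤ 1 / 5,
      closedBall y ρ ⊆ ball (0 : EuclideanSpace ℝ ι) 1 := by
    intro y hy ρ hρ w hw
    rw [mem_ball_zero_iff]
    rw [mem_closedBall, dist_eq_norm] at hy hw
    have h1 : ‖w‖ ≤ ‖w - y‖ + ‖y - -(r • e)‖ + ‖-(r • e)‖ := by
      have := norm_add₃_le (a := w - y) (b := y - -(r • e)) (c := -(r • e))
      rwa [sub_add_sub_cancel, sub_add_cancel] at this
    linarith
  have hcoord : ∀ (x y : EuclideanSpace ℝ ι), |y j - x j| ≤ dist y x := by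
    intro x y
    rw [dist_eq_norm, ← PiLp.sub_apply, ← Real.norm_eq_abs]
    exact PiLp.norm_apply_le _ _
  have hnear : ∀ y ∈ closedBall ((r / 2) • e) (r / 4),
      |u y| ≤ 10 * (L * ε) ^ β * M ^ (1 - β) := by
    intro y hy
    have key := h (1 / 5) (upperPart j u) (-(r • e)) M (K * ε / c) 0 (by norm_num)
      (continuous_upperPart j hu.continuous h0) (by positivity) ?_ ?_ ?_ y ?_
    · have hyj : 0 < y j := by
        have h1 := (abs_le.1 ((hcoord _ _).trans hy)).1
        rw [PiLp.smul_apply, hej, smul_eq_mul, mul_one] at h1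
        linarith
      rw [upperPart, if_neg hyj.not_ge] at key
      refine key.trans ?_
      have : 0 + 2 * (K * ε / c) ≤ L * ε := by
        rw [hL, add_mul, one_mul, zero_add]
        have : 2 * (K / c) * ε = 2 * (K * ε / c) := by ring
        linarith
      gcongr
    · intro y hy
      rw [upperPart]
      split_ifs
      · rwa [abs_zero]
      · exact hM y (hsub1 (hsub y hy 0 (by norm_num) (mem_closedBall_self le_rfl)))
    · intro ρ hρ hρ1 y hy
      refine (hK u hu (fun z hz => hlap z (hsub1 hz)) h0 ε hε hder y ρ hρ.le
        (hsub y hy ρ hρ1)).trans ?_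
      rw [mul_div_cancel₀ _ hc0.ne']
      exact mul_le_of_le_one_right (by positivity) (by linarith)
    · intro y hy
      have h1 := (abs_le.1 ((hcoord _ _).trans hy)).2
      rw [PiLp.neg_apply, PiLp.smul_apply, hej, smul_eq_mul, mul_one] at h1
      rw [upperPart, if_pos (by linarith), abs_zero]
    · refine closedBall_subset_closedBall' ?_ hy
      rw [dist_eq_norm, sub_neg_eq_add, ← add_smul, norm_smul, hen,
        Real.norm_of_nonneg (by positivity)]
      linarith
  have hfin := hchain u hu.continuous M hM
    (fun x ρ hρ hx => ballAvg_eq_of_coordLaplacian_eq_zero hu j hρ fun z hz => hlap z (hx hz))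
    ((r / 2) • e) (by
      rw [norm_smul, hen, Real.norm_of_nonneg (by positivity)]
      exact le_max_of_le_right (by linarith)) _ hnear z (hz.trans (le_max_left _ _))
  refine hfin.trans (mul_rpow_mul_rpow_le (by positivity) hε hM0 (by positivity) hC0.le
    hγ0.le hγ1.le hβ1.le (le_of_eq ?_))
  rw [Real.mul_rpow hL0.le hε]
  ring

end Global

section Localization

variable {ι : Type*} [Fintype ι]

theorem exists_contDiff_eqOn_ball (j : ι) {r R : ℝ} (hr : 0 < r) (hrR : r < R)
    {u : EuclideanSpace ℝ ι → ℝ} (hu : ContDiffOn ℝ 2 u (ball 0 R))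
    (h0 : ∀ z ∈ ball (0 : EuclideanSpace ℝ ι) R, z j = 0 → u z = 0) :
    ∃ v : EuclideanSpace ℝ ι → ℝ, ContDiff ℝ 2 v ∧ Set.EqOn v u (ball 0 r) ∧
      ∀ z, z j = 0 → v z = 0 := by
  let f : ContDiffBump (0 : EuclideanSpace ℝ ι) := ⟨r, (r + R) / 2, hr, by linarith⟩
  have hout : f.rOut < R := by change (r + R) / 2 < R; linarith
  refine ⟨fun z => f z * u z, contDiff_iff_contDiffAt.2 fun z => ?_, fun z hz => ?_,
    fun z hz => ?_⟩
  · by_cases hz : z ∈ ball (0 : EuclideanSpace ℝ ι) R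
    · exact f.contDiff.contDiffAt.mul (hu.contDiffAt (isOpen_ball.mem_nhds hz))
    · have hz' : z ∉ tsupport f := by
        rw [f.tsupport_eq]
        exact fun h => hz (closedBall_subset_ball hout h)
      refine (contDiffAt_const (c := (0 : ℝ))).congr_of_eventuallyEq ?_
      filter_upwards [notMem_tsupport_iff_eventuallyEq.1 hz'] with y hy
      rw [hy, Pi.zero_apply, zero_mul]
  · change f z * u z = u z
    rw [f.one_of_mem_closedBall (ball_subset_closedBall hz), one_mul]
  · by_cases hzR : z ∈ ball (0 : EuclideanSpace ℝ ι) R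
    · simp only [h0 z hzR hz, mul_zero]
    · have : f z = 0 := f.zero_of_le_dist (hout.le.trans (not_lt.1 hzR))
      simp only [this, zero_mul]

variable [DecidableEq ι]

theorem Filter.EventuallyEq.coordLaplacian_eq {u v : EuclideanSpace ℝ ι → ℝ}
    {z : EuclideanSpace ℝ ι} (h : u =ᶠ[nhds z] v) : coordLaplacian u z = coordLaplacian v z := by
  refine Finset.sum_congr rfl fun i _ => ?_
  have : (fun y => fderiv ℝ u y (EuclideanSpace.single i (1 : ℝ)))
      =ᶠ[nhds z] fun y => fderiv ℝ v y (EuclideanSpace.single i (1 : ℝ)) := by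
    filter_upwards [h.fderiv (𝕜 := ℝ)] with y hy
    rw [hy]
  rw [this.fderiv_eq]

theorem coordLaplacian_add {u v : EuclideanSpace ℝ ι → ℝ} (hu : ContDiff ℝ 2 u)
    (hv : ContDiff ℝ 2 v) (z : EuclideanSpace ℝ ι) :
    coordLaplacian (fun y => u y + v y) z = coordLaplacian u z + coordLaplacian v z := by
  simp only [coordLaplacian, ← Finset.sum_add_distrib]
  refine Finset.sum_congr rfl fun i _ => ?_
  have h1 : (fun y => fderiv ℝ (fun y => u y + v y) y (EuclideanSpace.single i (1 : ℝ)))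
      = fun y => fderiv ℝ u y (EuclideanSpace.single i (1 : ℝ))
        + fderiv ℝ v y (EuclideanSpace.single i (1 : ℝ)) := by
    ext y
    rw [fderiv_fun_add (hu.differentiable two_ne_zero y) (hv.differentiable two_ne_zero y),
      add_apply]
  rw [h1, fderiv_fun_add ((hu.fderiv_two_apply_const _).differentiable one_ne_zero z)
    ((hv.fderiv_two_apply_const _).differentiable one_ne_zero z), add_apply]

theorem coordLaplacian_comp_linearIsometryEquiv
    (s : EuclideanSpace ℝ ι ≃ₗᵢ[ℝ] EuclideanSpace ℝ ι)
    (hs : ∀ i, s (EuclideanSpace.single i (1 : ℝ)) = EuclideanSpace.single i (1 : ℝ) ∨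
      s (EuclideanSpace.single i (1 : ℝ)) = -EuclideanSpace.single i (1 : ℝ))
    (u : EuclideanSpace ℝ ι → ℝ) (z : EuclideanSpace ℝ ι) :
    coordLaplacian (fun y => u (s y)) z = coordLaplacian u (s z) := by
  have hcomp : ∀ (f : EuclideanSpace ℝ ι → ℝ) (y w : EuclideanSpace ℝ ι),
      fderiv ℝ (fun y => f (s y)) y w = fderiv ℝ f (s y) (s w) := by
    intro f y w
    have := s.toContinuousLinearEquiv.comp_right_fderiv (f := f) (x := y)
    exact congrArg (fun T => T w) this
  refine Finset.sum_congr rfl fun i _ => ?_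
  simp only [hcomp]
  rw [hcomp fun y => fderiv ℝ u y (s (EuclideanSpace.single i (1 : ℝ)))]
  rcases hs i with h | h
  · rw [h]
  · simp only [h, map_neg, fderiv_fun_neg, neg_apply, neg_neg]

end Localization

section Reflection

variable {ι : Type*} [Fintype ι] [DecidableEq ι]

/-- The reflection across the coordinate hyperplane `{z j = 0}`. -/
noncomputable def coordReflection (j : ι) : EuclideanSpace ℝ ι ≃ₗᵢ[ℝ] EuclideanSpace ℝ ι :=
  (ℝ ∙ (EuclideanSpace.single j (1 : ℝ)))ᗮ.reflection

theorem coordReflection_single_self (j : ι) :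
    coordReflection j (EuclideanSpace.single j (1 : ℝ)) = -EuclideanSpace.single j (1 : ℝ) :=
  Submodule.reflection_orthogonalComplement_singleton_eq_neg _

theorem coordReflection_of_apply_eq_zero {j : ι} {z : EuclideanSpace ℝ ι} (hz : z j = 0) :
    coordReflection j z = z := by
  refine Submodule.reflection_mem_subspace_eq_self ?_
  rw [Submodule.mem_orthogonal_singleton_iff_inner_right, EuclideanSpace.inner_single_left, hz,
    mul_zero]

theorem coordReflection_apply_self (j : ι) (z : EuclideanSpace ℝ ι) :
    coordReflection j z j = -z j := by
  have h1 : ∀ w : EuclideanSpace ℝ ι, inner ℝ (EuclideanSpace.single j (1 : ℝ)) w = w j := by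
    intro w
    rw [EuclideanSpace.inner_single_left, map_one, one_mul]
  rw [← h1 (coordReflection j z), ← (coordReflection j).inner_map_map, coordReflection_single_self,
    coordReflection, Submodule.reflection_reflection, inner_neg_left, h1]

theorem coordReflection_single (j i : ι) :
    coordReflection j (EuclideanSpace.single i (1 : ℝ)) = EuclideanSpace.single i (1 : ℝ) ∨
      coordReflection j (EuclideanSpace.single i (1 : ℝ)) = -EuclideanSpace.single i (1 : ℝ) := by
  rcases eq_or_ne i j with rfl | hij
  · exact Or.inr (coordReflection_single_self i)
  · exact Or.inl (coordReflection_of_apply_eq_zero (by simp [hij.symm]))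

theorem coordReflection_apply_eq_neg (j : ι) {R : ℝ} (hR : 1 < R)
    {u : EuclideanSpace ℝ ι → ℝ} (hu : ContDiffOn ℝ 2 u (ball 0 R))
    (hlap : ∀ z ∈ ball (0 : EuclideanSpace ℝ ι) R, coordLaplacian u z = 0)
    (h0 : ∀ z ∈ ball (0 : EuclideanSpace ℝ ι) R, z j = 0 → u z = 0)
    {z : EuclideanSpace ℝ ι} (hz : z ∈ ball (0 : EuclideanSpace ℝ ι) R) :
    u (coordReflection j z) = -u z := by
  obtain ⟨r, hr, hrR⟩ := exists_between (max_lt (mem_ball_zero_iff.1 hz) hR)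
  obtain ⟨hzr, hr1⟩ := max_lt_iff.1 hr
  obtain ⟨v, hv, hvu, hv0⟩ := exists_contDiff_eqOn_ball j (one_pos.trans hr1) hrR hu h0
  obtain ⟨β, C, hβ0, hβ1, hC, h⟩ := exists_abs_le_rpow_of_contDiff j hzr hr1
  set s := coordReflection j with hs
  have hmem : ∀ y ∈ ball (0 : EuclideanSpace ℝ ι) r, s y ∈ ball (0 : EuclideanSpace ℝ ι) r := by
    intro y hy
    rwa [mem_ball_zero_iff, s.norm_map, ← mem_ball_zero_iff]
  have hlapv : ∀ y ∈ ball (0 : EuclideanSpace ℝ ι) r, coordLaplacian v y = 0 := fun y hy => by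
    rw [(hvu.eventuallyEq_of_mem (isOpen_ball.mem_nhds hy)).coordLaplacian_eq]
    exact hlap y (ball_subset_ball hrR.le hy)
  have hvs : ContDiff ℝ 2 fun y => v (s y) := hv.comp s.contDiff
  have hw := hv.add hvs
  obtain ⟨M, hM⟩ := (isCompact_closedBall (0 : EuclideanSpace ℝ ι) r).exists_bound_of_continuousOn
    hw.continuous.continuousOn
  have key := h (fun y => v y + v (s y)) hw
    (fun y hy => by
      rw [coordLaplacian_add hv hvs,
        coordLaplacian_comp_linearIsometryEquiv s (coordReflection_single j), hlapv y hy,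
        hlapv _ (hmem y hy), add_zero])
    (fun y hy => by simp only [hs, coordReflection_of_apply_eq_zero hy, hv0 y hy, add_zero])
    M (fun y hy => hM y (ball_subset_closedBall hy)) 0 le_rfl
    (fun y _ hy => by
      have h1 : fderiv ℝ (fun y => v (s y)) y (EuclideanSpace.single j (1 : ℝ))
          = fderiv ℝ v (s y) (s (EuclideanSpace.single j (1 : ℝ))) :=
        congrArg (fun T => T (EuclideanSpace.single j (1 : ℝ)))
          (s.toContinuousLinearEquiv.comp_right_fderiv (f := v) (x := y))
      rw [fderiv_fun_add (hv.differentiable two_ne_zero y) (hvs.differentiable two_ne_zero y),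
        add_apply, h1, hs, coordReflection_of_apply_eq_zero hy, coordReflection_single_self,
        map_neg, add_neg_cancel, abs_zero])
    z le_rfl
  rw [Real.zero_rpow hβ0.ne', mul_zero, zero_mul] at key
  have hzr' : z ∈ ball (0 : EuclideanSpace ℝ ι) r := mem_ball_zero_iff.2 hzr
  have := abs_nonpos_iff.1 key
  rw [hvu hzr', hvu (hmem z hzr')] at this
  linarith

end Reflection

/-- Propagation of smallness for harmonic functions vanishing on a hyperplane
(Jerison–Lebeau): there are `β ∈ (0,1)` and `C > 0`, depending only on `n`, such that
if `u` is `C²` and harmonic on `B(0,2) ⊂ ℝⁿ⁺¹` with `u(x,0) = 0`, then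
`sup_{B(0,1)⁺} |u| ≤ C · (sup_{(x,0) ∈ B(0,1)} |∂_t u(x,0)|)^β · (sup_{B(0,2)⁺} |u|)^{1-β}`. -/
theorem propagation_of_smallness (n : ℕ) (hn : 1 ≤ n) :
    ∃ β : ℝ, 0 < β ∧ β < 1 ∧ ∃ C : ℝ, 0 < C ∧
      ∀ u : EuclideanSpace ℝ (Fin (n + 1)) → ℝ,
        ContDiffOn ℝ 2 u (ball (0 : EuclideanSpace ℝ (Fin (n + 1))) 2) →
        (∀ z ∈ ball (0 : EuclideanSpace ℝ (Fin (n + 1))) 2,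
          ∑ i : Fin (n + 1),
            fderiv ℝ (fun y => fderiv ℝ u y (EuclideanSpace.single i (1 : ℝ))) z
              (EuclideanSpace.single i (1 : ℝ)) = 0) →
        (∀ z ∈ ball (0 : EuclideanSpace ℝ (Fin (n + 1))) 2,
          z (Fin.last n) = 0 → u z = 0) →
        ∀ M : ℝ,
          (∀ z ∈ ball (0 : EuclideanSpace ℝ (Fin (n + 1))) 2,
            0 ≤ z (Fin.last n) → |u z| ≤ M) →
          ∀ z ∈ ball (0 : EuclideanSpace ℝ (Fin (n + 1))) 1,
            0 ≤ z (Fin.last n) →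
            |u z| ≤ C *
              (⨆ w : {w : EuclideanSpace ℝ (Fin (n + 1)) //
                  w ∈ ball (0 : EuclideanSpace ℝ (Fin (n + 1))) 1 ∧ w (Fin.last n) = 0},
                |fderiv ℝ u (w : EuclideanSpace ℝ (Fin (n + 1)))
                    (EuclideanSpace.single (Fin.last n) (1 : ℝ))|) ^ β
              * M ^ (1 - β) := by
  obtain ⟨β, C, hβ0, hβ1, hC, h⟩ := exists_abs_le_rpow_of_contDiff (Fin.last n)
    (a := 1) (R₀ := 3 / 2) (by norm_num) (by norm_num)
  refine ⟨β, hβ0, hβ1, C, hC, fun u hu hlap h0 M hM z hz _ => ?_⟩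
  have hMall : ∀ y ∈ ball (0 : EuclideanSpace ℝ (Fin (n + 1))) 2, |u y| ≤ M := by
    intro y hy
    rcases le_total 0 (y (Fin.last n)) with hy0 | hy0
    · exact hM y hy hy0
    · rw [← abs_neg, ← coordReflection_apply_eq_neg (Fin.last n) one_lt_two hu hlap h0 hy]
      refine hM _ ?_ ?_
      · rwa [mem_ball_zero_iff, LinearIsometryEquiv.norm_map, ← mem_ball_zero_iff]
      · rw [coordReflection_apply_self]; linarith
  obtain ⟨v, hv, hvu, hv0⟩ := exists_contDiff_eqOn_ball (Fin.last n) (r := 3 / 2)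
    (by norm_num) (by norm_num) hu h0
  have hsub : ball (0 : EuclideanSpace ℝ (Fin (n + 1))) (3 / 2) ⊆ ball 0 2 :=
    ball_subset_ball (by norm_num)
  have hsub1 : ball (0 : EuclideanSpace ℝ (Fin (n + 1))) 1 ⊆ ball 0 (3 / 2) :=
    ball_subset_ball (by norm_num)
  have heq : ∀ y ∈ ball (0 : EuclideanSpace ℝ (Fin (n + 1))) (3 / 2), v =ᶠ[nhds y] u :=
    fun y hy => hvu.eventuallyEq_of_mem (isOpen_ball.mem_nhds hy)
  obtain ⟨B, hB⟩ := (isCompact_closedBall (0 : EuclideanSpace ℝ (Fin (n + 1))) 1)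
    |>.exists_bound_of_continuousOn
      (hv.fderiv_two_apply_const (EuclideanSpace.single (Fin.last n) (1 : ℝ))).continuous.continuousOn
  rw [← hvu (hsub1 hz)]
  refine h v hv (fun y hy => (heq y hy).coordLaplacian_eq.trans (hlap y (hsub hy))) hv0 M
    (fun y hy => (hvu hy).symm ▸ hMall y (hsub hy)) _ (Real.iSup_nonneg fun _ => abs_nonneg _)
    (fun y hy hy0 => ?_) z (mem_ball_zero_iff.1 hz).le
  rw [(heq y (hsub1 hy)).fderiv_eq]
  refine le_ciSup (f := fun w : {w : EuclideanSpace ℝ (Fin (n + 1)) //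
      w ∈ ball (0 : EuclideanSpace ℝ (Fin (n + 1))) 1 ∧ w (Fin.last n) = 0} =>
    |fderiv ℝ u (w : EuclideanSpace ℝ (Fin (n + 1)))
      (EuclideanSpace.single (Fin.last n) (1 : ℝ))|) ⟨B, ?_⟩ ⟨y, hy, hy0⟩
  rintro _ ⟨w, rfl⟩
  have := hB w (ball_subset_closedBall w.2.1)
  rwa [(heq w (hsub1 w.2.1)).fderiv_eq, Real.norm_eq_abs] at this
end
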